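/- arXiv:0911.3633 — 2 statements merged into one kernel-verified Lean document; each statement's English description precedes it below -/
import Mathlib

section
/- Let A be a simple linear arrangement of n hyperplanes in ℝ^d (n ≥ d ≥ 2) with induced d-maximum class C ⊆ {0,1}^n. (a) If h is an affine hyperplane generic for A (A together with h is in general position) such that all points of intersection of d hyperplanes of A lie strictly on one side of h, then every (d−1)-cube of the (d−1)-maximum class induced on h is a cube of the boundary ∂C. (b) ∂C is the disjoint union of two (d−1)-maximum subclasses: there exist (d−1)-maximum classes C_1, C_2 ⊆ C such that every (d−1)-cube of ∂C is a cube of exactly one of C_1 and C_2. -/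
open Finset

namespace GeomCompress

/-- `C` shatters the coordinate set `Y`: every pattern on `Y` is realized by some concept. -/
def Shatters {n : ℕ} (C : Finset (Fin n → Bool)) (Y : Finset (Fin n)) : Prop :=
  ∀ p : Fin n → Bool, ∃ c ∈ C, ∀ i ∈ Y, c i = p i

/-- The VC dimension of `C` equals `d`. -/
def VCDimEq {n : ℕ} (C : Finset (Fin n → Bool)) (d : ℕ) : Prop :=
  (∃ Y : Finset (Fin n), Y.card = d ∧ Shatters C Y) ∧
    ∀ Y : Finset (Fin n), Shatters C Y → Y.card ≤ d

/-- `C` is a `d`-maximum class: VC dimension `d` and maximum possible cardinality. -/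
def IsMaximum {n : ℕ} (C : Finset (Fin n → Bool)) (d : ℕ) : Prop :=
  VCDimEq C d ∧ C.card = ∑ i ∈ Finset.range (d + 1), Nat.choose n i

/-- Hamming distance between two Boolean vectors. -/
def hamming {n : ℕ} (u v : Fin n → Bool) : ℕ :=
  (Finset.univ.filter fun i => u i ≠ v i).card

/-- Adjacency in the one-inclusion graph: differ in exactly one coordinate. -/
def Adj {n : ℕ} (u v : Fin n → Bool) : Prop := hamming u v = 1

instance {n : ℕ} (u v : Fin n → Bool) : Decidable (Adj u v) := by
  unfold Adj; infer_instance

/-- `Q` is a cube of `C` colored by `I`: a subset of `C` whose elements agree outside `I`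
and realize all patterns on `I`. -/
def IsCube {n : ℕ} (C Q : Finset (Fin n → Bool)) (I : Finset (Fin n)) : Prop :=
  Q ⊆ C ∧ (∀ u ∈ Q, ∀ v ∈ Q, ∀ i, i ∉ I → u i = v i) ∧
    ∀ p : Fin n → Bool, ∃ u ∈ Q, ∀ i ∈ I, u i = p i

/-- `v` is a corner vertex of `C`: there is a unique cube of maximum dimension among all
cubes of `C` containing `v`, and all neighbors of `v` in the one-inclusion graph of `C`
lie in that cube. -/
def IsCorner {n : ℕ} (C : Finset (Fin n → Bool)) (v : Fin n → Bool) : Prop :=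
  ∃ Q I, IsCube C Q I ∧ v ∈ Q ∧
    (∀ Q' I', IsCube C Q' I' → v ∈ Q' → I'.card ≤ I.card) ∧
    (∀ Q' I', IsCube C Q' I' → v ∈ Q' → I'.card = I.card → Q' = Q) ∧
    ∀ u ∈ C, Adj u v → u ∈ Q

/-- The class remaining after peeling the first `t` vertices of the ordering `v`. -/
def Peeled {n m : ℕ} (C : Finset (Fin n → Bool)) (v : Fin m → (Fin n → Bool)) (t : Fin m) :
    Finset (Fin n → Bool) :=
  C \ (Finset.univ.filter fun s : Fin m => s < t).image v

/-- `v` is a corner-peeling ordering of `C`: an enumeration of `C` such that each `v t`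
is a corner vertex of the class remaining before step `t`. -/
def IsCornerPeeling {n : ℕ} (C : Finset (Fin n → Bool)) (v : Fin C.card → (Fin n → Bool)) :
    Prop :=
  Function.Injective v ∧ (∀ t, v t ∈ C) ∧ ∀ t, IsCorner (Peeled C v t) (v t)

/-- Degree of `v` in the one-inclusion graph of `C`. -/
def degreeIn {n : ℕ} (C : Finset (Fin n → Bool)) (v : Fin n → Bool) : ℕ :=
  (C.filter fun u => Adj u v).card

/-- The colors of the edges incident to `v` in the one-inclusion graph of `C`. -/
def incidentColors {n : ℕ} (C : Finset (Fin n → Bool)) (v : Fin n → Bool) : Finset (Fin n) :=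
  Finset.univ.filter fun i => ∃ u ∈ C, Adj u v ∧ u i ≠ v i

/-- `C` is shortest-path closed: any two concepts are joined in the one-inclusion graph of
`C` by a path whose length is their Hamming distance. -/
def SPClosed {n : ℕ} (C : Finset (Fin n → Bool)) : Prop :=
  ∀ u ∈ C, ∀ v ∈ C, ∃ p : ℕ → (Fin n → Bool),
    p 0 = u ∧ p (hamming u v) = v ∧ (∀ k ≤ hamming u v, p k ∈ C) ∧
    ∀ k < hamming u v, Adj (p k) (p (k + 1))

/-- `Q` (colored by `I`, with `I.card = d - 1`) is a cube of the boundary `∂C` of the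
`d`-maximum class `C`: it is a face of exactly one `d`-cube of `C`. -/
def IsBoundaryCube {n : ℕ} (C : Finset (Fin n → Bool)) (d : ℕ)
    (Q : Finset (Fin n → Bool)) (I : Finset (Fin n)) : Prop :=
  IsCube C Q I ∧ I.card = d - 1 ∧
    (∃ Q' I', IsCube C Q' I' ∧ I'.card = d ∧ Q ⊆ Q' ∧ I ⊆ I') ∧
    ∀ Q₁ I₁ Q₂ I₂, IsCube C Q₁ I₁ → I₁.card = d → Q ⊆ Q₁ → I ⊆ I₁ →
      IsCube C Q₂ I₂ → I₂.card = d → Q ⊆ Q₂ → I ⊆ I₂ → Q₁ = Q₂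

/-- Standard inner product on `Fin d → ℝ`. -/
def dotR {d : ℕ} (x y : Fin d → ℝ) : ℝ := ∑ i, x i * y i

/-- `x` lies on none of the hyperplanes `⟪a i, ·⟫ = b i`. -/
def OnNoHyperplane {d N : ℕ} (a : Fin N → Fin d → ℝ) (b : Fin N → ℝ) (x : Fin d → ℝ) :
    Prop :=
  ∀ i, dotR (a i) x ≠ b i

/-- The sign vector of the point `x` with respect to the oriented hyperplanes `(a, b)`. -/
noncomputable def signVec {d N : ℕ} (a : Fin N → Fin d → ℝ) (b : Fin N → ℝ)
    (x : Fin d → ℝ) : Fin N → Bool :=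
  fun i => decide (b i < dotR (a i) x)

/-- `C` is the concept class induced by the arrangement `(a, b)`: the set of sign vectors
of points lying on none of the hyperplanes. -/
def IsInducedClass {d N : ℕ} (a : Fin N → Fin d → ℝ) (b : Fin N → ℝ)
    (C : Finset (Fin N → Bool)) : Prop :=
  ∀ c, c ∈ C ↔ ∃ x : Fin d → ℝ, OnNoHyperplane a b x ∧ signVec a b x = c

/-- A simple linear arrangement in `ℝ^d`: every `≤ d` of the hyperplanes are in general
position (normals linearly independent, so every `k ≤ d` of them intersect in an affine
subspace of dimension `d - k`), and every `d+1` of them have empty common intersection. -/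
def SimpleArrangement (d : ℕ) {N : ℕ} (a : Fin N → Fin d → ℝ) (b : Fin N → ℝ) : Prop :=
  (∀ S : Finset (Fin N), S.card ≤ d → LinearIndependent ℝ (fun i : S => a i.1)) ∧
    ∀ S : Finset (Fin N), S.card = d + 1 → ¬∃ x : Fin d → ℝ, ∀ i ∈ S, dotR (a i) x = b i

/-- Membership in the open unit ball (Klein model of hyperbolic space `H^k`). -/
def inBall {k : ℕ} (x : Fin k → ℝ) : Prop := ∑ i, x i ^ 2 < 1

/-- A simple hyperbolic `d`-arrangement in the Klein model `H^k`: every `d` of the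
hyperplanes intersect inside the unit ball in a `(k-d)`-dimensional hyperbolic plane
(normals independent and common point inside the ball), and every `d+1` of them have
empty common intersection inside the ball. -/
def SimpleHyperbolicArrangement (d : ℕ) {k N : ℕ} (a : Fin N → Fin k → ℝ)
    (b : Fin N → ℝ) : Prop :=
  (∀ S : Finset (Fin N), S.card = d →
      LinearIndependent ℝ (fun i : S => a i.1) ∧
        ∃ x : Fin k → ℝ, inBall x ∧ ∀ i ∈ S, dotR (a i) x = b i) ∧
    ∀ S : Finset (Fin N), S.card = d + 1 →
      ¬∃ x : Fin k → ℝ, inBall x ∧ ∀ i ∈ S, dotR (a i) x = b i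

/-- The concept class induced by a hyperbolic arrangement: sign vectors of points of the
open unit ball lying on none of the hyperplanes. -/
def IsInducedClassH {k N : ℕ} (a : Fin N → Fin k → ℝ) (b : Fin N → ℝ)
    (C : Finset (Fin N → Bool)) : Prop :=
  ∀ c, c ∈ C ↔ ∃ x : Fin k → ℝ, inBall x ∧ OnNoHyperplane a b x ∧ signVec a b x = c

/-- A generic arrangement of oriented affine hyperplanes in `ℝ^n`: every subcollection of
`k` hyperplanes, `2 ≤ k ≤ n`, either has empty common intersection or intersects
transversely (normals linearly independent, giving an affine subspace of dim `n - k`). -/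
def GenericArrangement {n N : ℕ} (a : Fin N → Fin n → ℝ) (b : Fin N → ℝ) : Prop :=
  ∀ S : Finset (Fin N), 2 ≤ S.card → S.card ≤ n →
    (¬∃ x : Fin n → ℝ, ∀ i ∈ S, dotR (a i) x = b i) ∨
      LinearIndependent ℝ (fun i : S => a i.1)

/-- `C` is a maximal class of VC dimension `d`: adding any new concept increases the VC
dimension. -/
def IsMaximalClass {n : ℕ} (C : Finset (Fin n → Bool)) (d : ℕ) : Prop :=
  VCDimEq C d ∧
    ∀ c : Fin n → Bool, c ∉ C →
      ∃ Y : Finset (Fin n), d < Y.card ∧ Shatters (insert c C) Y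

/-- A path in the one-inclusion graph of `C` avoiding `C'`, from a vertex of `Q1` to a
vertex of `Q2`. -/
def CConnPath {n : ℕ} (C C' Q1 Q2 : Finset (Fin n → Bool)) : Prop :=
  ∃ (L : ℕ) (p : ℕ → Fin n → Bool),
    p 0 ∈ Q1 ∧ p L ∈ Q2 ∧ (∀ j ≤ L, p j ∈ C ∧ p j ∉ C') ∧
      ∀ j < L, Adj (p j) (p (j + 1))

/-- `Q1` and `Q2` are `d`-cubes of `C` joined by a path of the one-inclusion graph of `C`
avoiding `C'`. -/
def CComponentRel {n : ℕ} (C C' : Finset (Fin n → Bool)) (d : ℕ)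
    (Q1 Q2 : Finset (Fin n → Bool)) : Prop :=
  (∃ I, IsCube C Q1 I ∧ I.card = d) ∧ (∃ I, IsCube C Q2 I ∧ I.card = d) ∧
    CConnPath C C' Q1 Q2

/-- `Comp` enumerates the `C'`-connected components of `C`: each component is a union of
`d`-cubes of `C`, every `d`-cube lies in exactly one component, and two `d`-cubes lie in
the same component iff they are related under the transitive closure of
`C'`-connectedness. -/
def IsComponents {n : ℕ} (C C' : Finset (Fin n → Bool)) (d : ℕ) {k : ℕ}
    (Comp : Fin k → Finset (Fin n → Bool)) : Prop :=
  (∀ q, ∀ x ∈ Comp q, ∃ Q I, IsCube C Q I ∧ I.card = d ∧ x ∈ Q ∧ Q ⊆ Comp q) ∧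
  (∀ Q I, IsCube C Q I → I.card = d → ∃ q, Q ⊆ Comp q) ∧
  (∀ q q' Q I, IsCube C Q I → I.card = d → Q ⊆ Comp q → Q ⊆ Comp q' → q = q') ∧
  ∀ q Q1 I1, IsCube C Q1 I1 → I1.card = d → Q1 ⊆ Comp q →
    ∀ Q2 I2, IsCube C Q2 I2 → I2.card = d →
      (Q2 ⊆ Comp q ↔ Relation.TransGen (CComponentRel C C' d) Q1 Q2)

/-- Append the bit `b` as a new last coordinate. -/
def app {n : ℕ} (c : Fin n → Bool) (b : Bool) : Fin (n + 1) → Bool := Fin.snoc c b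

/-- The lift `(C' × {0,1}) ∪ ⋃_q (Comp q × {p q})`. -/
def LiftClass {n k : ℕ} (C' : Finset (Fin n → Bool))
    (Comp : Fin k → Finset (Fin n → Bool)) (p : Fin k → Bool) :
    Finset (Fin (n + 1) → Bool) :=
  C'.image (fun c => app c false) ∪ C'.image (fun c => app c true) ∪
    Finset.univ.biUnion fun q => (Comp q).image fun c => app c (p q)

/-! ### Linear algebra of the pairing `dotR` -/

section Pairing

variable {d n : ℕ}

lemma dotR_eq_dotProduct (x y : Fin d → ℝ) : dotR x y = x ⬝ᵥ y := rfl

lemma dotR_add (x y z : Fin d → ℝ) : dotR x (y + z) = dotR x y + dotR x z :=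
  dotProduct_add x y z

lemma dotR_smul (t : ℝ) (x y : Fin d → ℝ) : dotR x (t • y) = t * dotR x y :=
  dotProduct_smul t x y

lemma dotR_neg (x y : Fin d → ℝ) : dotR x (-y) = -dotR x y :=
  dotProduct_neg x y

lemma neg_dotR (x y : Fin d → ℝ) : dotR (-x) y = -dotR x y :=
  neg_dotProduct x y

lemma isLinearMap_dotR (x : Fin d → ℝ) : IsLinearMap ℝ (dotR x) :=
  ⟨dotR_add x, fun t y => dotR_smul t x y⟩

/-- Linearly independent covectors take arbitrary prescribed values at some vector. -/
lemma exists_dotR_eq_of_linearIndependent {a : Fin n → Fin d → ℝ} {S : Finset (Fin n)}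
    (hS : LinearIndependent ℝ (fun i : S => a i.1)) (c : Fin n → ℝ) :
    ∃ v, ∀ i ∈ S, dotR (a i) v = c i := by
  have hrank : (Matrix.of fun i : S => a i.1).rank = Fintype.card S :=
    LinearIndependent.rank_matrix hS
  have htop : (Matrix.of fun i : S => a i.1).mulVecLin.range = ⊤ := by
    apply Submodule.eq_top_of_finrank_eq
    rw [Module.finrank_fintype_fun_eq_card]
    exact hrank
  obtain ⟨v, hv⟩ := LinearMap.range_eq_top.1 htop (fun i : S => c i.1)
  exact ⟨v, fun i hi => congrFun hv ⟨i, hi⟩⟩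

/-- Two vectors with the same pairings against `d` independent covectors of `ℝ^d` agree. -/
lemma eq_of_dotR_eq {a : Fin n → Fin d → ℝ} {S : Finset (Fin n)} (hcard : S.card = d)
    (hS : LinearIndependent ℝ (fun i : S => a i.1)) {x y : Fin d → ℝ}
    (h : ∀ i ∈ S, dotR (a i) x = dotR (a i) y) : x = y := by
  have hsurj : Function.Surjective (Matrix.of fun i : S => a i.1).mulVecLin := by
    intro w
    obtain ⟨v, hv⟩ := exists_dotR_eq_of_linearIndependent hS
      (fun i => if hi : i ∈ S then w ⟨i, hi⟩ else 0)
    refine ⟨v, funext fun i => ?_⟩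
    have := hv i.1 i.2
    simp only [i.2, dite_true] at this
    exact this
  have hinj := (LinearMap.injective_iff_surjective_of_finrank_eq_finrank
    (by simp [hcard])).2 hsurj
  exact hinj (funext fun i => h i.1 i.2)

end Pairing

/-! ### Cubes and shattering -/

section Cubes

variable {n : ℕ}

/-- All Boolean vectors that agree with `c` outside `I`. -/
def cubeAt (c : Fin n → Bool) (I : Finset (Fin n)) : Finset (Fin n → Bool) :=
  Finset.univ.filter fun u => ∀ i, i ∉ I → u i = c i

lemma mem_cubeAt {c u : Fin n → Bool} {I : Finset (Fin n)} :
    u ∈ cubeAt c I ↔ ∀ i, i ∉ I → u i = c i := by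
  simp [cubeAt]

lemma self_mem_cubeAt (c : Fin n → Bool) (I : Finset (Fin n)) : c ∈ cubeAt c I :=
  mem_cubeAt.2 fun _ _ => rfl

lemma cubeAt_mono (c : Fin n → Bool) {I J : Finset (Fin n)} (h : I ⊆ J) :
    cubeAt c I ⊆ cubeAt c J := fun _ hu =>
  mem_cubeAt.2 fun i hi => mem_cubeAt.1 hu i fun hI => hi (h hI)

lemma isCube_cubeAt {C : Finset (Fin n → Bool)} {c : Fin n → Bool} {I : Finset (Fin n)}
    (h : cubeAt c I ⊆ C) : IsCube C (cubeAt c I) I := by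
  refine ⟨h, fun u hu v hv i hi => ?_, fun p => ⟨fun i => if i ∈ I then p i else c i, ?_, ?_⟩⟩
  · rw [mem_cubeAt.1 hu i hi, mem_cubeAt.1 hv i hi]
  · exact mem_cubeAt.2 fun i hi => by simp [hi]
  · intro i hi
    simp [hi]

lemma IsCube.eq_cubeAt {C Q : Finset (Fin n → Bool)} {I : Finset (Fin n)} (h : IsCube C Q I)
    {c : Fin n → Bool} (hc : c ∈ Q) : Q = cubeAt c I := by
  ext u
  rw [mem_cubeAt]
  refine ⟨fun hu i hi => h.2.1 u hu c hc i hi, fun hu => ?_⟩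
  obtain ⟨w, hw, hwu⟩ := h.2.2 u
  have : w = u := by
    funext i
    by_cases hi : i ∈ I
    · exact hwu i hi
    · rw [hu i hi]; exact h.2.1 w hw c hc i hi
  exact this ▸ hw

lemma IsCube.exists_mem {C Q : Finset (Fin n → Bool)} {I : Finset (Fin n)}
    (h : IsCube C Q I) : ∃ c, c ∈ Q :=
  let ⟨u, hu, _⟩ := h.2.2 fun _ => false
  ⟨u, hu⟩

lemma colors_subset_of_cubeAt_eq {c : Fin n → Bool} {I J : Finset (Fin n)}
    (h : cubeAt c I = cubeAt c J) : I ⊆ J := by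
  intro i hi
  by_contra hJ
  have hmem : Function.update c i (!c i) ∈ cubeAt c I := mem_cubeAt.2 fun k hk => by
    rw [Function.update_of_ne]
    rintro rfl
    exact hk hi
  rw [h] at hmem
  simpa using mem_cubeAt.1 hmem i hJ

lemma colors_eq_of_cubeAt_eq {c : Fin n → Bool} {I J : Finset (Fin n)}
    (h : cubeAt c I = cubeAt c J) : I = J :=
  (colors_subset_of_cubeAt_eq h).antisymm (colors_subset_of_cubeAt_eq h.symm)

/-- Pajor's inequality for Boolean concept classes. -/
lemma card_le_card_shattered (C : Finset (Fin n → Bool)) [DecidablePred (Shatters C)] :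
    C.card ≤ (Finset.univ.filter fun Y => Shatters C Y).card := by
  let supp : (Fin n → Bool) → Finset (Fin n) := fun c => Finset.univ.filter fun i => c i = true
  have hinj : Function.Injective supp := by
    intro c c' h
    funext i
    have := congrArg (i ∈ ·) h
    simp only [supp, Finset.mem_filter, Finset.mem_univ, true_and, eq_iff_iff] at this
    exact Bool.eq_iff_iff.2 this
  rw [← Finset.card_image_of_injective C hinj]
  refine (Finset.card_le_card_shatterer _).trans (Finset.card_le_card fun Y hY => ?_)
  rw [Finset.mem_shatterer] at hY
  refine Finset.mem_filter.2 ⟨Finset.mem_univ _, fun p => ?_⟩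
  obtain ⟨u, hu, hYu⟩ := hY (Finset.filter_subset (fun i => p i = true) Y)
  obtain ⟨c, hc, rfl⟩ := Finset.mem_image.1 hu
  refine ⟨c, hc, fun i hi => ?_⟩
  have := congrArg (i ∈ ·) hYu
  simp only [supp, Finset.mem_inter, Finset.mem_filter, Finset.mem_univ, true_and, hi,
    eq_iff_iff] at this
  exact Bool.eq_iff_iff.2 this

/-- A class contains at least as many concepts as there are color sets of its cubes. -/
lemma card_colors_le_card (C : Finset (Fin n → Bool)) (T : Finset (Finset (Fin n)))
    (hT : ∀ I ∈ T, ∃ c, cubeAt c I ⊆ C) : T.card ≤ C.card := by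
  classical
  have hdisj : Disjoint (T.image compl) (Finset.univ.filter fun Y => Shatters Cᶜ Y) := by
    rw [Finset.disjoint_left]
    intro Y hY hsh
    obtain ⟨I, hI, rfl⟩ := Finset.mem_image.1 hY
    obtain ⟨c, hc⟩ := hT I hI
    obtain ⟨u, hu, huc⟩ := (Finset.mem_filter.1 hsh).2 c
    exact Finset.mem_compl.1 hu
      (hc (mem_cubeAt.2 fun i hi => huc i (Finset.mem_compl.2 hi)))
  have hle := Finset.card_le_univ (T.image compl ∪ Finset.univ.filter fun Y => Shatters Cᶜ Y)
  rw [Finset.card_union_of_disjoint hdisj, Finset.card_image_of_injective _ compl_injective]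
    at hle
  have hpaj := card_le_card_shattered Cᶜ
  have hcompl := Finset.card_add_card_compl C
  simp only [Fintype.card_finset, Fintype.card_fin, Fintype.card_fun, Fintype.card_bool]
    at hle hcompl
  omega

lemma card_filter_card_le (n k : ℕ) :
    (Finset.univ.filter fun Y : Finset (Fin n) => Y.card ≤ k).card =
      ∑ i ∈ Finset.range (k + 1), n.choose i := by
  rw [Finset.card_eq_sum_card_fiberwise (f := Finset.card) (t := Finset.range (k + 1))]
  · refine Finset.sum_congr rfl fun i hi => ?_
    have hset : (Finset.univ.filter fun Y : Finset (Fin n) => Y.card ≤ k).filter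
        (fun Y => Y.card = i) = Finset.powersetCard i Finset.univ := by
      ext Y
      simp only [Finset.mem_filter, Finset.mem_univ, true_and, Finset.mem_powersetCard,
        Finset.subset_univ, and_iff_right_iff_imp]
      have := Finset.mem_range.1 hi
      omega
    rw [hset, Finset.card_powersetCard, Finset.card_univ, Fintype.card_fin]
  · intro Y hY
    simp only [Finset.coe_filter, Finset.mem_univ, true_and, Set.mem_ofPred_eq] at hY
    simp only [Finset.coe_range, Set.mem_Iio]
    omega

/-- A class with a cube of every color set of size `k`, shattering nothing larger, is
`k`-maximum. -/
lemma isMaximum_of_cubes {C : Finset (Fin n → Bool)} {k : ℕ} (hk : k ≤ n)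
    (hcube : ∀ I : Finset (Fin n), I.card = k → ∃ c, cubeAt c I ⊆ C)
    (hsh : ∀ Y, Shatters C Y → Y.card ≤ k) : IsMaximum C k := by
  classical
  refine ⟨⟨?_, hsh⟩, le_antisymm ?_ ?_⟩
  · obtain ⟨Y, -, hY⟩ := Finset.exists_subset_card_eq
      (s := (Finset.univ : Finset (Fin n))) (n := k) (by simpa using hk)
    obtain ⟨c, hc⟩ := hcube Y hY
    refine ⟨Y, hY, fun p => ?_⟩
    obtain ⟨u, hu, hup⟩ := (isCube_cubeAt hc).2.2 p
    exact ⟨u, hc hu, hup⟩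
  · rw [← card_filter_card_le]
    exact (card_le_card_shattered C).trans (Finset.card_le_card fun Y hY =>
      Finset.mem_filter.2 ⟨Finset.mem_univ _, hsh Y (Finset.mem_filter.1 hY).2⟩)
  · rw [← card_filter_card_le]
    refine card_colors_le_card C _ fun I hI => ?_
    obtain ⟨J, hIJ, -, hJ⟩ := Finset.exists_subsuperset_card_eq (Finset.subset_univ I)
      (Finset.mem_filter.1 hI).2 (by simpa using hk)
    obtain ⟨c, hc⟩ := hcube J hJ
    exact ⟨c, (cubeAt_mono c hIJ).trans hc⟩

end Cubes

/-! ### Cubes of classes induced on convex sets and points of intersection flats -/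

section Flats

variable {d n : ℕ} {a : Fin n → Fin d → ℝ} {b : Fin n → ℝ}

open Classical in
/-- The sign vectors of the points of `K` lying on none of the hyperplanes. -/
noncomputable def classOn (a : Fin n → Fin d → ℝ) (b : Fin n → ℝ) (K : Set (Fin d → ℝ)) :
    Finset (Fin n → Bool) :=
  Finset.univ.filter fun c => ∃ x ∈ K, OnNoHyperplane a b x ∧ signVec a b x = c

lemma mem_classOn {K : Set (Fin d → ℝ)} {c : Fin n → Bool} :
    c ∈ classOn a b K ↔ ∃ x ∈ K, OnNoHyperplane a b x ∧ signVec a b x = c := by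
  simp [classOn]

lemma classOn_mono {K L : Set (Fin d → ℝ)} (h : K ⊆ L) : classOn a b K ⊆ classOn a b L :=
  fun _ hc =>
    let ⟨x, hx, hxc⟩ := mem_classOn.1 hc
    mem_classOn.2 ⟨x, h hx, hxc⟩

lemma IsInducedClass.eq_classOn {C : Finset (Fin n → Bool)} (hC : IsInducedClass a b C) :
    C = classOn a b Set.univ := by
  ext c
  rw [hC c, mem_classOn]
  simp

/-- A convex set meeting all the orthants cut out by some hyperplanes meets their
intersection. -/
lemma exists_mem_forall_dotR_eq (I : Finset (Fin n)) :
    ∀ {K : Set (Fin d → ℝ)}, Convex ℝ K →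
      (∀ p : Fin n → Bool, ∃ x ∈ K, ∀ i ∈ I,
        (p i = true → b i < dotR (a i) x) ∧ (p i = false → dotR (a i) x < b i)) →
      ∃ x ∈ K, ∀ i ∈ I, dotR (a i) x = b i := by
  induction I using Finset.induction_on with
  | empty =>
    intro K _ h
    obtain ⟨x, hx, -⟩ := h fun _ => false
    exact ⟨x, hx, by simp⟩
  | insert j J hj ih =>
    intro K hK h
    obtain ⟨x, ⟨hxK, hx⟩, hxJ⟩ := ih
      (hK.inter (convex_halfSpace_gt (isLinearMap_dotR (a j)) (b j))) fun p => by
        obtain ⟨x, hx, hxp⟩ := h (Function.update p j true)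
        refine ⟨x, ⟨hx, (hxp j (Finset.mem_insert_self _ _)).1 (by simp)⟩, fun i hi => ?_⟩
        have := hxp i (Finset.mem_insert_of_mem hi)
        rwa [Function.update_of_ne (ne_of_mem_of_not_mem hi hj)] at this
    obtain ⟨y, ⟨hyK, hy⟩, hyJ⟩ := ih
      (hK.inter (convex_halfSpace_lt (isLinearMap_dotR (a j)) (b j))) fun p => by
        obtain ⟨x, hx, hxp⟩ := h (Function.update p j false)
        refine ⟨x, ⟨hx, (hxp j (Finset.mem_insert_self _ _)).2 (by simp)⟩, fun i hi => ?_⟩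
        have := hxp i (Finset.mem_insert_of_mem hi)
        rwa [Function.update_of_ne (ne_of_mem_of_not_mem hi hj)] at this
    replace hx : b j < dotR (a j) x := hx
    replace hy : dotR (a j) y < b j := hy
    have hpos : 0 < dotR (a j) x - dotR (a j) y := by linarith
    refine ⟨((b j - dotR (a j) y) / (dotR (a j) x - dotR (a j) y)) • x +
      ((dotR (a j) x - b j) / (dotR (a j) x - dotR (a j) y)) • y,
      hK hxK hyK (div_nonneg (by linarith) hpos.le) (div_nonneg (by linarith) hpos.le)
        (by field_simp; ring), fun i hi => ?_⟩
    rw [dotR_add, dotR_smul, dotR_smul]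
    rcases Finset.mem_insert.1 hi with rfl | hi
    · field_simp
      ring
    · rw [hxJ i hi, hyJ i hi]
      field_simp
      ring

/-- `x` is a point of `K` on all the hyperplanes in `I` and on no other one, on the sides of
the latter prescribed by `c`. -/
def IsFlatPoint (a : Fin n → Fin d → ℝ) (b : Fin n → ℝ) (K : Set (Fin d → ℝ))
    (c : Fin n → Bool) (I : Finset (Fin n)) (x : Fin d → ℝ) : Prop :=
  x ∈ K ∧ (∀ i ∈ I, dotR (a i) x = b i) ∧
    ∀ i, i ∉ I → dotR (a i) x ≠ b i ∧ (c i = true ↔ b i < dotR (a i) x)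

lemma exists_isFlatPoint_of_cubeAt_subset {K : Set (Fin d → ℝ)} (hK : Convex ℝ K)
    {c : Fin n → Bool} {I : Finset (Fin n)} (h : cubeAt c I ⊆ classOn a b K) :
    ∃ x, IsFlatPoint a b K c I x := by
  let R : Set (Fin d → ℝ) :=
    ⋂ i, {x | i ∉ I → dotR (a i) x ≠ b i ∧ (c i = true ↔ b i < dotR (a i) x)}
  have hR : Convex ℝ R := by
    refine convex_iInter fun i => ?_
    by_cases hi : i ∈ I
    · convert convex_univ (𝕜 := ℝ) (E := Fin d → ℝ)
      ext x
      simp [hi]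
    · cases hc : c i
      · refine (congrArg (Convex ℝ) (Set.ext fun x => ?_)).mp
          (convex_halfSpace_lt (isLinearMap_dotR (a i)) (b i))
        simp only [hi, not_false_eq_true, forall_const, Bool.false_eq_true, false_iff,
          not_lt, Set.mem_ofPred_eq]
        exact ⟨fun h => ⟨h.ne, h.le⟩, fun h => lt_of_le_of_ne h.2 h.1⟩
      · refine (congrArg (Convex ℝ) (Set.ext fun x => ?_)).mp
          (convex_halfSpace_gt (isLinearMap_dotR (a i)) (b i))
        simp only [hi, not_false_eq_true, forall_const, true_iff, Set.mem_ofPred_eq]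
        exact ⟨fun h => ⟨h.ne', h⟩, fun h => h.2⟩
  obtain ⟨x, ⟨hxK, hxR⟩, hx⟩ := exists_mem_forall_dotR_eq (a := a) (b := b) I (hK.inter hR)
    fun p => by
      have hmem : (fun i => if i ∈ I then p i else c i) ∈ cubeAt c I :=
        mem_cubeAt.2 fun i hi => by simp [hi]
      obtain ⟨x, hxK, hx, hsign⟩ := mem_classOn.1 (h hmem)
      refine ⟨x, ⟨hxK, Set.mem_iInter.2 fun i hi => ⟨hx i, ?_⟩⟩, fun i hi => ?_⟩
      · have := congrFun hsign i
        simp only [signVec, hi, if_false] at this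
        rw [← this, decide_eq_true_iff]
      · have := congrFun hsign i
        simp only [signVec, hi, if_true] at this
        rw [← this, decide_eq_true_iff, decide_eq_false_iff_not]
        exact ⟨id, fun h => lt_of_le_of_ne (not_lt.1 h) (hx i)⟩
  exact ⟨x, hxK, hx, fun i hi => Set.mem_iInter.1 hxR i hi⟩

/-- All the cells around a point of an intersection flat belong to the induced class, as long
as the point can move in `K` to all sides of the hyperplanes containing it. -/
lemma IsFlatPoint.cubeAt_subset {K : Set (Fin d → ℝ)} {c : Fin n → Bool}
    {I : Finset (Fin n)} {x : Fin d → ℝ} (hx : IsFlatPoint a b K c I x)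
    (hdir : ∀ p : Fin n → ℝ, ∃ v : Fin d → ℝ,
      (∀ i ∈ I, dotR (a i) v = p i) ∧ ∀ t : ℝ, x + t • v ∈ K) :
    cubeAt c I ⊆ classOn a b K := by
  intro u hu
  obtain ⟨v, hv, hvK⟩ := hdir fun i => if u i then 1 else -1
  have hsmall : ∀ i, ∀ᶠ t in nhdsWithin (0 : ℝ) (Set.Ioi 0),
      dotR (a i) (x + t • v) ≠ b i ∧ (u i = true ↔ b i < dotR (a i) (x + t • v)) := by
    intro i
    simp only [dotR_add, dotR_smul]
    by_cases hi : i ∈ I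
    · filter_upwards [self_mem_nhdsWithin] with t ht
      have ht : 0 < t := ht
      rw [hx.2.1 i hi, hv i hi]
      cases u i
      · simp [ht.ne', ht.le]
      · simp [ht.ne', ht]
    · have hlim : Filter.Tendsto (fun t : ℝ => dotR (a i) x + t * dotR (a i) v)
          (nhdsWithin 0 (Set.Ioi 0)) (nhds (dotR (a i) x)) := by
        have hcont : Continuous fun t : ℝ => dotR (a i) x + t * dotR (a i) v := by fun_prop
        simpa using (hcont.tendsto 0).mono_left nhdsWithin_le_nhds
      obtain ⟨hne, hside⟩ := hx.2.2 i hi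
      rw [mem_cubeAt.1 hu i hi]
      rcases lt_or_gt_of_ne hne with hlt | hgt
      · filter_upwards [hlim.eventually_lt_const hlt] with t ht
        exact ⟨ht.ne, hside.trans (iff_of_false hlt.not_gt ht.not_gt)⟩
      · filter_upwards [hlim.eventually_const_lt hgt] with t ht
        exact ⟨ht.ne', hside.trans (iff_of_true hgt ht)⟩
  obtain ⟨t, ht⟩ := (Filter.eventually_all.2 hsmall).exists
  refine mem_classOn.2 ⟨x + t • v, hvK t, fun i => (ht i).1, funext fun i => ?_⟩
  rw [signVec, Bool.eq_iff_iff, decide_eq_true_iff, (ht i).2]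

lemma IsFlatPoint.cubeAt_subset_univ (hA : SimpleArrangement d a b) {c : Fin n → Bool}
    {I : Finset (Fin n)} (hI : I.card ≤ d) {x : Fin d → ℝ}
    (hx : IsFlatPoint a b Set.univ c I x) : cubeAt c I ⊆ classOn a b Set.univ :=
  hx.cubeAt_subset fun p =>
    let ⟨v, hv⟩ := exists_dotR_eq_of_linearIndependent (hA.1 I hI) p
    ⟨v, hv, fun _ => Set.mem_univ _⟩

end Flats

/-! ### Generic hyperplanes -/

section Generic

variable {d n : ℕ} {a : Fin n → Fin d → ℝ} {b : Fin n → ℝ}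

/-- The hyperplane `⟪g, ·⟫ = e` is transverse to the intersection lines of the arrangement
and avoids its vertices. -/
def IsGenericFor (a : Fin n → Fin d → ℝ) (b : Fin n → ℝ) (g : Fin d → ℝ) (e : ℝ) : Prop :=
  (∀ S : Finset (Fin n), S.card + 1 = d → ∀ (c : Fin n → ℝ) (t : ℝ),
    ∃ v, (∀ i ∈ S, dotR (a i) v = c i) ∧ dotR g v = t) ∧
  ∀ S : Finset (Fin n), S.card = d → ¬∃ x, (∀ i ∈ S, dotR (a i) x = b i) ∧ dotR g x = e

lemma IsGenericFor.neg {g : Fin d → ℝ} {e : ℝ} (h : IsGenericFor a b g e) :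
    IsGenericFor a b (-g) (-e) := by
  refine ⟨fun S hS c t => ?_, fun S hS => ?_⟩
  · obtain ⟨v, hv, hgv⟩ := h.1 S hS c (-t)
    exact ⟨v, hv, by rw [neg_dotR, hgv, neg_neg]⟩
  · rintro ⟨x, hx, hgx⟩
    exact h.2 S hS ⟨x, hx, by rwa [neg_dotR, neg_inj] at hgx⟩

lemma isGenericFor_of_simpleArrangement_snoc {g : Fin d → ℝ} {e : ℝ}
    (h : SimpleArrangement d (Fin.snoc a g : Fin (n + 1) → Fin d → ℝ)
      (Fin.snoc b e : Fin (n + 1) → ℝ)) : IsGenericFor a b g e := by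
  have hlast : ∀ S : Finset (Fin n), Fin.last n ∉ S.map Fin.castSuccEmb := by
    intro S hS
    obtain ⟨i, -, hi⟩ := Finset.mem_map.1 hS
    exact (Fin.castSucc_lt_last i).ne hi
  refine ⟨fun S hS c t => ?_, fun S hS => ?_⟩
  · obtain ⟨v, hv⟩ := exists_dotR_eq_of_linearIndependent
      (h.1 (insert (Fin.last n) (S.map Fin.castSuccEmb))
        (by rw [Finset.card_insert_of_notMem (hlast S), Finset.card_map]; omega))
      (Fin.snoc c t : Fin (n + 1) → ℝ)
    refine ⟨v, fun i hi => ?_, ?_⟩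
    · simpa using hv i.castSucc
        (Finset.mem_insert_of_mem (Finset.mem_map_of_mem Fin.castSuccEmb hi))
    · simpa using hv (Fin.last n) (Finset.mem_insert_self _ _)
  · rintro ⟨x, hx, hgx⟩
    refine h.2 (insert (Fin.last n) (S.map Fin.castSuccEmb))
      (by rw [Finset.card_insert_of_notMem (hlast S), Finset.card_map, hS]) ⟨x, fun i hi => ?_⟩
    rcases Finset.mem_insert.1 hi with rfl | hi
    · simpa using hgx
    · obtain ⟨j, hj, rfl⟩ := Finset.mem_map.1 hi
      simpa using hx j hj

/-- Some covector is transverse to all the intersection lines. -/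
lemma exists_transverse (a : Fin n → Fin d → ℝ) :
    ∃ g : Fin d → ℝ, ∀ S : Finset (Fin n), S.card + 1 = d →
      g ∉ Submodule.span ℝ (a '' (S : Set (Fin n))) := by
  by_contra! hcon
  obtain ⟨S, hS⟩ := Subspace.exists_eq_top_of_iUnion_eq_univ (k := ℝ) (E := Fin d → ℝ)
    (p := fun S : {S : Finset (Fin n) // S.card + 1 = d} =>
      Submodule.span ℝ (a '' (S.1 : Set (Fin n)))) (by
        refine Set.eq_univ_of_forall fun g => ?_
        obtain ⟨S, hS, hg⟩ := hcon g
        exact Set.mem_iUnion.2 ⟨⟨S, hS⟩, hg⟩)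
  classical
  have hle := finrank_span_finset_le_card (R := ℝ) (S.1.image a)
  have hcard := Finset.card_image_le (s := S.1) (f := a)
  rw [Finset.coe_image, Set.finrank, hS, finrank_top, Module.finrank_fintype_fun_eq_card,
    Fintype.card_fin] at hle
  have := S.2
  omega

/-- The vertices of the arrangement lie in a bounded slab. -/
lemma exists_forall_vertex_abs_lt (hA : SimpleArrangement d a b) (g : Fin d → ℝ) :
    ∃ e : ℝ, ∀ (S : Finset (Fin n)) (x : Fin d → ℝ), S.card = d →
      (∀ i ∈ S, dotR (a i) x = b i) → |dotR g x| < e := by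
  have hfin : {x : Fin d → ℝ | ∃ S : Finset (Fin n), S.card = d ∧
      ∀ i ∈ S, dotR (a i) x = b i}.Finite := by
    refine (Set.finite_iUnion (f := fun S : Finset (Fin n) =>
      {x : Fin d → ℝ | S.card = d ∧ ∀ i ∈ S, dotR (a i) x = b i}) fun S => ?_).subset ?_
    · refine Set.Subsingleton.finite fun x hx y hy => ?_
      exact eq_of_dotR_eq hx.1 (hA.1 S hx.1.le) fun i hi => (hx.2 i hi).trans (hy.2 i hi).symm
    · rintro x ⟨S, hS⟩
      exact Set.mem_iUnion.2 ⟨S, hS⟩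
  obtain ⟨e, he⟩ := (hfin.image fun x => |dotR g x|).bddAbove
  refine ⟨e + 1, fun S x hS hx => ?_⟩
  have : |dotR g x| ≤ e := he (Set.mem_image_of_mem _ (show x ∈ {x : Fin d → ℝ |
    ∃ S : Finset (Fin n), S.card = d ∧ ∀ i ∈ S, dotR (a i) x = b i} from ⟨S, hS, hx⟩))
  linarith

/-- A direction together with a bound for which the two far hyperplanes are generic. -/
lemma exists_isGenericFor_far (hA : SimpleArrangement d a b) :
    ∃ (g : Fin d → ℝ) (e : ℝ), IsGenericFor a b g e ∧ IsGenericFor a b g (-e) ∧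
      ∀ (S : Finset (Fin n)) (x : Fin d → ℝ), S.card = d →
        (∀ i ∈ S, dotR (a i) x = b i) → |dotR g x| < e := by
  obtain ⟨g, hg⟩ := exists_transverse a
  obtain ⟨e, he⟩ := exists_forall_vertex_abs_lt hA g
  have htrans : ∀ S : Finset (Fin n), S.card + 1 = d → ∀ (c : Fin n → ℝ) (t : ℝ),
      ∃ v, (∀ i ∈ S, dotR (a i) v = c i) ∧ dotR g v = t := by
    intro S hS c t
    obtain ⟨f, hfg, hf⟩ := Submodule.exists_le_ker_of_notMem (hg S hS)
    obtain ⟨w, rfl⟩ := (dotProductEquiv ℝ (Fin d)).surjective f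
    have hgw : dotR g w ≠ 0 := by
      rw [dotR_eq_dotProduct, dotProduct_comm]
      exact hfg
    have haw : ∀ i ∈ S, dotR (a i) w = 0 := by
      intro i hi
      rw [dotR_eq_dotProduct, dotProduct_comm]
      exact hf (Submodule.subset_span (Set.mem_image_of_mem a hi))
    obtain ⟨v, hv⟩ := exists_dotR_eq_of_linearIndependent (hA.1 S (by omega)) c
    refine ⟨v + ((t - dotR g v) / dotR g w) • w, fun i hi => ?_, ?_⟩
    · rw [dotR_add, dotR_smul, hv i hi, haw i hi, mul_zero, add_zero]
    · rw [dotR_add, dotR_smul]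
      field_simp
      ring
  refine ⟨g, e, ⟨htrans, ?_⟩, ⟨htrans, ?_⟩, he⟩
  · rintro S hS ⟨x, hx, hgx⟩
    exact absurd (he S x hS hx) (by rw [hgx]; exact (le_abs_self e).not_gt)
  · rintro S hS ⟨x, hx, hgx⟩
    exact absurd (he S x hS hx) (by rw [hgx, abs_neg]; exact (le_abs_self e).not_gt)

lemma convex_hyperplane_dotR (g : Fin d → ℝ) (e : ℝ) : Convex ℝ {x | dotR g x = e} :=
  convex_hyperplane (isLinearMap_dotR g) e

lemma IsGenericFor.cubeAt_subset {g : Fin d → ℝ} {e : ℝ} (h : IsGenericFor a b g e)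
    {c : Fin n → Bool} {I : Finset (Fin n)} (hI : I.card + 1 = d) {x : Fin d → ℝ}
    (hx : IsFlatPoint a b {x | dotR g x = e} c I x) :
    cubeAt c I ⊆ classOn a b {x | dotR g x = e} := by
  refine hx.cubeAt_subset fun p => ?_
  obtain ⟨v, hv, hgv⟩ := h.1 I hI p 0
  refine ⟨v, hv, fun t => ?_⟩
  have hgx : dotR g x = e := hx.1
  simp [dotR_add, dotR_smul, hgv, hgx]

lemma IsGenericFor.isMaximum_classOn (hd : 1 ≤ d) (hdn : d ≤ n) {g : Fin d → ℝ} {e : ℝ}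
    (h : IsGenericFor a b g e) : IsMaximum (classOn a b {x | dotR g x = e}) (d - 1) := by
  refine isMaximum_of_cubes (by omega) (fun I hI => ?_) fun Y hY => ?_
  · obtain ⟨x, hx, hgx⟩ := h.1 I (by omega) b e
    refine ⟨signVec a b x, h.cubeAt_subset (x := x) (by omega) ⟨hgx, hx, fun i hi => ⟨?_, ?_⟩⟩⟩
    · intro hi'
      refine h.2 (insert i I) (by rw [Finset.card_insert_of_notMem hi]; omega)
        ⟨x, fun k hk => ?_, hgx⟩
      rcases Finset.mem_insert.1 hk with rfl | hk
      · exact hi'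
      · exact hx k hk
    · rw [signVec, decide_eq_true_iff]
  · by_contra! hcard
    obtain ⟨Z, hZY, hZ⟩ := Finset.exists_subset_card_eq (s := Y) (n := d) (by omega)
    obtain ⟨x, hgx, hx⟩ := exists_mem_forall_dotR_eq (a := a) (b := b) Y
      (convex_hyperplane_dotR g e) fun p => by
        obtain ⟨c, hc, hcp⟩ := hY p
        obtain ⟨x, hgx, hx, rfl⟩ := mem_classOn.1 hc
        refine ⟨x, hgx, fun i hi => ?_⟩
        rw [← hcp i hi, signVec, decide_eq_true_iff, decide_eq_false_iff_not]
        exact ⟨id, fun h => lt_of_le_of_ne (not_lt.1 h) (hx i)⟩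
    exact h.2 Z hZ ⟨x, fun i hi => hx i (hZY hi), hgx⟩

end Generic

/-! ### Intersection lines and boundary cubes -/

section Lines

variable {d n : ℕ} {a : Fin n → Fin d → ℝ} {b : Fin n → ℝ} {c : Fin n → Bool}
  {I : Finset (Fin n)} {x v : Fin d → ℝ}

/-- `x` is a point in the interior of an edge of the arrangement, lying on the hyperplanes
in `I` on the sides `c` of the other ones, and `v` is a direction of the line of that edge. -/
structure IsEdgePoint (a : Fin n → Fin d → ℝ) (b : Fin n → ℝ) (c : Fin n → Bool)
    (I : Finset (Fin n)) (x v : Fin d → ℝ) : Prop where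
  simple : SimpleArrangement d a b
  card : I.card + 1 = d
  flat : IsFlatPoint a b Set.univ c I x
  dir : ∀ i ∈ I, dotR (a i) v = 0
  dir_ne : v ≠ 0

/-- The parameter at which the line `x + t • v` crosses the `j`-th hyperplane. -/
noncomputable def crossing (a : Fin n → Fin d → ℝ) (b : Fin n → ℝ) (x v : Fin d → ℝ)
    (j : Fin n) : ℝ :=
  (b j - dotR (a j) x) / dotR (a j) v

lemma crossing_neg (j : Fin n) : crossing a b x (-v) j = -crossing a b x v j := by
  rw [crossing, crossing, dotR_neg, div_neg]

namespace IsEdgePoint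

lemma neg (h : IsEdgePoint a b c I x v) : IsEdgePoint a b c I x (-v) :=
  ⟨h.simple, h.card, h.flat, fun i hi => by rw [dotR_neg, h.dir i hi, neg_zero],
    neg_ne_zero.2 h.dir_ne⟩

lemma card_insert (h : IsEdgePoint a b c I x v) {j : Fin n} (hj : j ∉ I) :
    (insert j I).card = d := by
  rw [Finset.card_insert_of_notMem hj, h.card]

lemma eq_of_dotR_eq (h : IsEdgePoint a b c I x v) {j : Fin n} (hj : j ∉ I)
    {y z : Fin d → ℝ} (hyz : ∀ i ∈ insert j I, dotR (a i) y = dotR (a i) z) : y = z :=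
  GeomCompress.eq_of_dotR_eq (h.card_insert hj) (h.simple.1 _ (h.card_insert hj).le) hyz

lemma slope_ne (h : IsEdgePoint a b c I x v) {j : Fin n} (hj : j ∉ I) :
    dotR (a j) v ≠ 0 := by
  intro hv
  refine h.dir_ne (h.eq_of_dotR_eq hj fun i hi => ?_)
  rw [(isLinearMap_dotR (a i)).map_zero]
  rcases Finset.mem_insert.1 hi with rfl | hi
  · exact hv
  · exact h.dir i hi

lemma dotR_sub_eq (h : IsEdgePoint a b c I x v) {j : Fin n} (hj : j ∉ I) (t : ℝ) :
    dotR (a j) (x + t • v) - b j = (t - crossing a b x v j) * dotR (a j) v := by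
  have := h.slope_ne hj
  rw [dotR_add, dotR_smul, crossing]
  field_simp
  ring

lemma dotR_eq (h : IsEdgePoint a b c I x v) {i : Fin n} (hi : i ∈ I) (t : ℝ) :
    dotR (a i) (x + t • v) = b i := by
  rw [dotR_add, dotR_smul, h.flat.2.1 i hi, h.dir i hi, mul_zero, add_zero]

lemma dotR_crossing (h : IsEdgePoint a b c I x v) {j : Fin n} (hj : j ∉ I) :
    ∀ i ∈ insert j I, dotR (a i) (x + crossing a b x v j • v) = b i := by
  intro i hi
  rcases Finset.mem_insert.1 hi with rfl | hi
  · have := h.dotR_sub_eq hj (crossing a b x v i)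
    rw [sub_self, zero_mul] at this
    linarith
  · exact h.dotR_eq hi _

lemma exists_eq_add_smul (h : IsEdgePoint a b c I x v) {j : Fin n} (hj : j ∉ I)
    {y : Fin d → ℝ} (hy : ∀ i ∈ I, dotR (a i) y = b i) : ∃ t : ℝ, y = x + t • v := by
  refine ⟨(dotR (a j) y - dotR (a j) x) / dotR (a j) v, h.eq_of_dotR_eq hj fun i hi => ?_⟩
  rcases Finset.mem_insert.1 hi with rfl | hi
  · have := h.slope_ne hj
    rw [dotR_add, dotR_smul]
    field_simp
    ring
  · rw [hy i hi, h.dotR_eq hi]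

lemma crossing_ne_zero (h : IsEdgePoint a b c I x v) {j : Fin n} (hj : j ∉ I) :
    crossing a b x v j ≠ 0 :=
  div_ne_zero (sub_ne_zero.2 (h.flat.2.2 j hj).1.symm) (h.slope_ne hj)

lemma crossing_ne (h : IsEdgePoint a b c I x v) {j k : Fin n} (hj : j ∉ I) (hk : k ∉ I)
    (hjk : j ≠ k) : crossing a b x v j ≠ crossing a b x v k := by
  intro heq
  refine h.simple.2 (insert j (insert k I)) ?_ ⟨x + crossing a b x v k • v, fun i hi => ?_⟩
  · rw [Finset.card_insert_of_notMem (by simp [hjk, hj]), h.card_insert hk]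
  · rcases Finset.mem_insert.1 hi with rfl | hi
    · rw [← heq]
      exact h.dotR_crossing hj i (Finset.mem_insert_self _ _)
    · exact h.dotR_crossing hk i hi

/-- A point of the line is off the `j`-th hyperplane, on the side given by `c`, iff the
crossing with that hyperplane does not separate it from `x`. -/
lemma side_iff (h : IsEdgePoint a b c I x v) {j : Fin n} (hj : j ∉ I) (t : ℝ) :
    (dotR (a j) (x + t • v) ≠ b j ∧ (c j = true ↔ b j < dotR (a j) (x + t • v))) ↔
      0 < (0 - crossing a b x v j) * (t - crossing a b x v j) := by
  obtain ⟨hne, hside⟩ := h.flat.2.2 j hj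
  have hm : 0 < dotR (a j) v * dotR (a j) v := mul_self_pos.2 (h.slope_ne hj)
  have h0 := h.dotR_sub_eq hj 0
  rw [zero_smul, add_zero] at h0
  have ht := h.dotR_sub_eq hj t
  have hprod : (dotR (a j) x - b j) * (dotR (a j) (x + t • v) - b j) =
      ((0 - crossing a b x v j) * (t - crossing a b x v j)) *
        (dotR (a j) v * dotR (a j) v) := by
    rw [h0, ht]
    ring
  rw [← mul_pos_iff_of_pos_right hm, ← hprod, hside]
  rcases lt_or_gt_of_ne hne with hlt | hgt
  · rw [← neg_mul_neg, mul_pos_iff_of_pos_left (neg_pos.2 (sub_neg.2 hlt)), neg_pos, sub_neg]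
    simp only [hlt.not_gt, false_iff, not_lt]
    exact ⟨fun h => lt_of_le_of_ne h.2 h.1, fun h => ⟨h.ne, h.le⟩⟩
  · rw [mul_pos_iff_of_pos_left (sub_pos.2 hgt), sub_pos]
    simp only [show b j < dotR (a j) x from hgt, true_iff]
    exact ⟨fun h => h.2, fun h => ⟨h.ne', h⟩⟩

lemma cubeAt_subset (h : IsEdgePoint a b c I x v) :
    cubeAt c I ⊆ classOn a b Set.univ :=
  h.flat.cubeAt_subset_univ h.simple (by have := h.card; omega)

/-- The nearest crossing behind an edge point gives a `d`-cube containing the cube of the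
edge. -/
lemma exists_nearest_crossing (h : IsEdgePoint a b c I x v)
    (hex : ∃ j, j ∉ I ∧ crossing a b x v j < 0) :
    ∃ k, k ∉ I ∧ crossing a b x v k < 0 ∧ cubeAt c (insert k I) ⊆ classOn a b Set.univ := by
  classical
  obtain ⟨k, hk, hmax⟩ := Finset.exists_max_image
    (Finset.univ.filter fun j => j ∉ I ∧ crossing a b x v j < 0) (crossing a b x v)
    (let ⟨j, hj⟩ := hex; ⟨j, by simpa using hj⟩)
  simp only [Finset.mem_filter, Finset.mem_univ, true_and] at hk hmax
  obtain ⟨hkI, hk0⟩ := hk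
  refine ⟨k, hkI, hk0, IsFlatPoint.cubeAt_subset_univ h.simple (h.card_insert hkI).le
    (x := x + crossing a b x v k • v) ⟨Set.mem_univ _, h.dotR_crossing hkI, fun i hi => ?_⟩⟩
  rw [Finset.mem_insert, not_or] at hi
  rw [h.side_iff hi.2]
  have hne := h.crossing_ne hi.2 hkI hi.1
  rcases lt_or_ge (crossing a b x v i) 0 with hneg | hpos
  · have := lt_of_le_of_ne (hmax i ⟨hi.2, hneg⟩) hne
    exact mul_pos (by linarith) (by linarith)
  · have := lt_of_le_of_ne hpos (h.crossing_ne_zero hi.2).symm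
    exact mul_pos_of_neg_of_neg (by linarith) (by linarith)

lemma exists_eq_insert (h : IsEdgePoint a b c I x v) {J : Finset (Fin n)} (hJ : J.card = d)
    (hIJ : I ⊆ J) : ∃ k, k ∉ I ∧ J = insert k I := by
  obtain ⟨k, hk, hkJ⟩ := (Finset.covBy_iff_exists_insert.1
    (Finset.covBy_iff_card_sdiff_eq_one.2 ⟨hIJ, by
      have := h.card
      rw [Finset.card_sdiff_of_subset hIJ]
      omega⟩))
  exact ⟨k, hk, hkJ.symm⟩

/-- The only hyperplane that can bound an unbounded edge is the last one crossed. -/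
lemma crossing_lt_of_cubeAt_insert_subset (h : IsEdgePoint a b c I x v)
    (hneg : ∀ j, j ∉ I → crossing a b x v j < 0) {k l : Fin n} (hk : k ∉ I) (hl : l ∉ I)
    (hkl : k ≠ l) (hsub : cubeAt c (insert k I) ⊆ classOn a b Set.univ) :
    crossing a b x v l < crossing a b x v k := by
  obtain ⟨y, -, hy, hside⟩ := exists_isFlatPoint_of_cubeAt_subset convex_univ hsub
  have hyk : y = x + crossing a b x v k • v :=
    h.eq_of_dotR_eq hk fun i hi => (hy i hi).trans (h.dotR_crossing hk i hi).symm
  have := hside l (by simp [hkl.symm, hl])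
  rw [hyk, h.side_iff hl] at this
  have hl0 := hneg l hl
  have := pos_of_mul_pos_right this (by linarith)
  linarith

/-- The cube of an unbounded edge is a boundary cube. -/
lemma isBoundaryCube (h : IsEdgePoint a b c I x v)
    (hneg : ∀ j, j ∉ I → crossing a b x v j < 0) (hdn : d ≤ n) :
    IsBoundaryCube (classOn a b Set.univ) d (cubeAt c I) I := by
  have hcard := h.card
  obtain ⟨j, hj⟩ : ∃ j, j ∉ I := by
    by_contra! hall
    rw [Finset.eq_univ_of_forall hall, Finset.card_univ, Fintype.card_fin] at hcard
    omega
  refine ⟨isCube_cubeAt h.cubeAt_subset, by omega, ?_, ?_⟩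
  · obtain ⟨k, hk, -, hsub⟩ := h.exists_nearest_crossing ⟨j, hj, hneg j hj⟩
    exact ⟨_, _, isCube_cubeAt hsub, h.card_insert hk,
      cubeAt_mono c (Finset.subset_insert k I), Finset.subset_insert k I⟩
  · intro Q₁ I₁ Q₂ I₂ hQ₁ hI₁ hQQ₁ hII₁ hQ₂ hI₂ hQQ₂ hII₂
    have e₁ := hQ₁.eq_cubeAt (hQQ₁ (self_mem_cubeAt c I))
    have e₂ := hQ₂.eq_cubeAt (hQQ₂ (self_mem_cubeAt c I))
    obtain ⟨k, hk, rfl⟩ := h.exists_eq_insert hI₁ hII₁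
    obtain ⟨l, hl, rfl⟩ := h.exists_eq_insert hI₂ hII₂
    subst e₁ e₂
    by_cases hkl : k = l
    · rw [hkl]
    · exact absurd (h.crossing_lt_of_cubeAt_insert_subset hneg hk hl hkl hQ₁.1)
        (h.crossing_lt_of_cubeAt_insert_subset hneg hl hk (Ne.symm hkl) hQ₂.1).not_gt

/-- The edge of a boundary cube is unbounded in at least one direction. -/
lemma crossing_neg_or_pos (h : IsEdgePoint a b c I x v)
    (hb : IsBoundaryCube (classOn a b Set.univ) d (cubeAt c I) I) :
    (∀ j, j ∉ I → crossing a b x v j < 0) ∨ ∀ j, j ∉ I → crossing a b x (-v) j < 0 := by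
  by_contra! hcon
  obtain ⟨⟨j, hj, hj0⟩, ⟨i, hi, hi0⟩⟩ := hcon
  have hj0 := lt_of_le_of_ne hj0 (h.crossing_ne_zero hj).symm
  have hi0 := lt_of_le_of_ne hi0 (h.neg.crossing_ne_zero hi).symm
  rw [crossing_neg] at hi0
  obtain ⟨k, hk, hk0, hksub⟩ := h.exists_nearest_crossing ⟨i, hi, by linarith⟩
  obtain ⟨l, hl, hl0, hlsub⟩ := h.neg.exists_nearest_crossing
    ⟨j, hj, by rw [crossing_neg]; linarith⟩
  rw [crossing_neg] at hl0
  have heq := hb.2.2.2 _ _ _ _ (isCube_cubeAt hksub) (h.card_insert hk)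
    (cubeAt_mono c (Finset.subset_insert k I)) (Finset.subset_insert k I)
    (isCube_cubeAt hlsub) (h.card_insert hl)
    (cubeAt_mono c (Finset.subset_insert l I)) (Finset.subset_insert l I)
  have hmem : k ∈ insert l I := colors_eq_of_cubeAt_eq heq ▸ Finset.mem_insert_self k I
  rcases Finset.mem_insert.1 hmem with rfl | hkI
  · linarith
  · exact hk hkI

/-- An unbounded edge meets the far generic hyperplane on its side, but not the opposite
one. -/
lemma isCube_far (h : IsEdgePoint a b c I x v)
    (hneg : ∀ j, j ∉ I → crossing a b x v j < 0) {j : Fin n} (hj : j ∉ I)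
    {g : Fin d → ℝ} {e : ℝ} (hgv : dotR g v = 1) (hgen : IsGenericFor a b g e)
    (hbound : ∀ (S : Finset (Fin n)) (y : Fin d → ℝ), S.card = d →
      (∀ i ∈ S, dotR (a i) y = b i) → |dotR g y| < e) :
    IsCube (classOn a b {y | dotR g y = e}) (cubeAt c I) I ∧
      ¬ IsCube (classOn a b {y | dotR g y = -e}) (cubeAt c I) I := by
  have hslab : ∀ i, i ∉ I → |dotR g x + crossing a b x v i| < e := by
    intro i hi
    have := hbound _ _ (h.card_insert hi) (h.dotR_crossing hi)
    rwa [dotR_add, dotR_smul, hgv, mul_one] at this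
  constructor
  · refine isCube_cubeAt (hgen.cubeAt_subset h.card (x := x + (e - dotR g x) • v)
      ⟨?_, fun i hi => h.dotR_eq hi _, fun i hi => (h.side_iff hi _).2 ?_⟩)
    · change dotR g _ = e
      rw [dotR_add, dotR_smul, hgv]
      ring
    · have h1 := hneg i hi
      have h2 := (abs_lt.1 (hslab i hi)).2
      exact mul_pos (by linarith) (by linarith)
  · intro hcube
    obtain ⟨y, hgy, hy, hside⟩ :=
      exists_isFlatPoint_of_cubeAt_subset (convex_hyperplane_dotR g (-e)) hcube.1
    obtain ⟨t, rfl⟩ := h.exists_eq_add_smul hj hy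
    have hgy : dotR g (x + t • v) = -e := hgy
    rw [dotR_add, dotR_smul, hgv] at hgy
    have hpos := (h.side_iff hj t).1 (hside j hj)
    have h1 := hneg j hj
    have h2 := (abs_lt.1 (hslab j hj)).1
    have := pos_of_mul_pos_right hpos (by linarith)
    linarith

end IsEdgePoint

/-- Any cube with `d - 1` colors in the class of a generic hyperplane having all vertices
strictly below it is a boundary cube. -/
lemma isBoundaryCube_of_below (hA : SimpleArrangement d a b) (hd : 1 ≤ d) (hdn : d ≤ n)
    {g : Fin d → ℝ} {e : ℝ} (hgen : IsGenericFor a b g e)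
    (hbelow : ∀ (S : Finset (Fin n)) (y : Fin d → ℝ), S.card = d →
      (∀ i ∈ S, dotR (a i) y = b i) → dotR g y < e)
    {Q : Finset (Fin n → Bool)} (hQ : IsCube (classOn a b {x | dotR g x = e}) Q I)
    (hI : I.card = d - 1) : IsBoundaryCube (classOn a b Set.univ) d Q I := by
  obtain ⟨c, hc⟩ := hQ.exists_mem
  obtain rfl := hQ.eq_cubeAt hc
  obtain ⟨x, hgx, hx, hside⟩ :=
    exists_isFlatPoint_of_cubeAt_subset (convex_hyperplane_dotR g e) hQ.1
  have hgx : dotR g x = e := hgx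
  obtain ⟨v, hv, hgv⟩ := hgen.1 I (by omega) (fun _ => 0) 1
  have hedge : IsEdgePoint a b c I x v := by
    refine ⟨hA, by omega, ⟨Set.mem_univ _, hx, hside⟩, hv, ?_⟩
    rintro rfl
    rw [(isLinearMap_dotR g).map_zero] at hgv
    exact zero_ne_one hgv
  refine hedge.isBoundaryCube (fun j hj => ?_) hdn
  have := hbelow _ _ (hedge.card_insert hj) (hedge.dotR_crossing hj)
  rw [dotR_add, dotR_smul, hgv, hgx] at this
  linarith

end Lines

/-- Let `A` be a simple linear arrangement of `n` hyperplanes in `ℝ^d`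
(`n ≥ d ≥ 2`) with induced `d`-maximum class `C`. (a) If `h` is generic for `A` and all
`d`-fold intersection points of `A` lie strictly on one side of `h`, then every
`(d-1)`-cube of the class induced on `h` is a cube of the boundary `∂C`. (b) `∂C` is the
disjoint union of two `(d-1)`-maximum subclasses. -/
theorem stmt8 (d n : ℕ) (hd : 2 ≤ d) (hdn : d ≤ n)
    (a : Fin n → Fin d → ℝ) (b : Fin n → ℝ) (hA : SimpleArrangement d a b)
    (C : Finset (Fin n → Bool)) (hC : IsInducedClass a b C) :
    (∀ (g : Fin d → ℝ) (e : ℝ),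
      SimpleArrangement d (Fin.snoc a g) (Fin.snoc b e) →
      ((∀ x : Fin d → ℝ,
          (∃ S : Finset (Fin n), S.card = d ∧ ∀ i ∈ S, dotR (a i) x = b i) →
          dotR g x < e) ∨
       (∀ x : Fin d → ℝ,
          (∃ S : Finset (Fin n), S.card = d ∧ ∀ i ∈ S, dotR (a i) x = b i) →
          e < dotR g x)) →
      ∀ C' : Finset (Fin n → Bool),
        (∀ c, c ∈ C' ↔
          ∃ x : Fin d → ℝ, dotR g x = e ∧ OnNoHyperplane a b x ∧ signVec a b x = c) →
        ∀ Q I, IsCube C' Q I → I.card = d - 1 → IsBoundaryCube C d Q I) ∧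
    (∃ C1 C2 : Finset (Fin n → Bool),
      IsMaximum C1 (d - 1) ∧ IsMaximum C2 (d - 1) ∧ C1 ⊆ C ∧ C2 ⊆ C ∧
      ∀ Q I, IsBoundaryCube C d Q I →
        ((IsCube C1 Q I ∧ ¬ IsCube C2 Q I) ∨ (¬ IsCube C1 Q I ∧ IsCube C2 Q I))) := by
  obtain rfl := hC.eq_classOn
  refine ⟨fun g e hge hside C' hC' Q I hQ hI => ?_, ?_⟩
  · have hgen := isGenericFor_of_simpleArrangement_snoc hge
    obtain rfl : C' = classOn a b {x | dotR g x = e} := by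
      ext c
      rw [hC' c, mem_classOn]
      rfl
    rcases hside with hlt | hgt
    · exact isBoundaryCube_of_below hA (by omega) hdn hgen
        (fun S y hS hy => hlt y ⟨S, hS, hy⟩) hQ hI
    · refine isBoundaryCube_of_below hA (by omega) hdn hgen.neg
        (fun S y hS hy => ?_) (Q := Q) (I := I) ?_ hI
      · rw [neg_dotR]
        exact neg_lt_neg (hgt y ⟨S, hS, hy⟩)
      · simpa only [neg_dotR, neg_inj] using hQ
  · obtain ⟨g, e, hgen, hgen', hbound⟩ := exists_isGenericFor_far hA
    refine ⟨classOn a b {x | dotR g x = e}, classOn a b {x | dotR g x = -e},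
      hgen.isMaximum_classOn (by omega) hdn, hgen'.isMaximum_classOn (by omega) hdn,
      classOn_mono (Set.subset_univ _), classOn_mono (Set.subset_univ _), fun Q I hQ => ?_⟩
    have hI := hQ.2.1
    obtain ⟨c, hc⟩ := hQ.1.exists_mem
    obtain rfl := hQ.1.eq_cubeAt hc
    obtain ⟨x, hx⟩ := exists_isFlatPoint_of_cubeAt_subset convex_univ hQ.1.1
    obtain ⟨v, hv, hgv⟩ := hgen.1 I (by omega) (fun _ => 0) 1
    have hedge : IsEdgePoint a b c I x v := by
      refine ⟨hA, by omega, hx, hv, ?_⟩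
      rintro rfl
      rw [(isLinearMap_dotR g).map_zero] at hgv
      exact zero_ne_one hgv
    obtain ⟨j, hj⟩ : ∃ j, j ∉ I := by
      by_contra! hall
      rw [Finset.eq_univ_of_forall hall, Finset.card_univ, Fintype.card_fin] at hI
      omega
    rcases hedge.crossing_neg_or_pos hQ with hneg | hneg
    · exact Or.inl (hedge.isCube_far hneg hj hgv hgen hbound)
    · have hfar := hedge.neg.isCube_far hneg hj (g := -g) (e := e)
        (by rw [neg_dotR, dotR_neg, hgv, neg_neg])
        (by simpa using hgen'.neg)
        (fun S y hS hy => by rw [neg_dotR, abs_neg]; exact hbound S y hS hy)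
      simp only [neg_dotR, neg_eq_iff_eq_neg, neg_neg] at hfar
      exact Or.inr hfar.symm

end GeomCompress
end

section
/- Any d-maximum class C ⊆ {0,1}^n induced by a simple hyperbolic d-arrangement of n hyperplanes in H^k (k ≥ d ≥ 1) can be d-corner-peeled. -/
open Finset

namespace GeomCompress

/-- The real sign of a bit. -/
def bitSign (t : Bool) : ℝ := if t then 1 else -1

/-- The closed polyhedron of points whose weak sign vector is `c`. -/
def closedCell {k n : ℕ} (A : Fin n → EuclideanSpace ℝ (Fin k)) (b : Fin n → ℝ)
    (c : Fin n → Bool) : Set (EuclideanSpace ℝ (Fin k)) :=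
  {x | ∀ i, 0 ≤ bitSign (c i) * (inner ℝ (A i) x - b i)}

/-- `p` is the point of minimal norm of the closed cell of `c`, in variational form. -/
def IsNearest {k n : ℕ} (A : Fin n → EuclideanSpace ℝ (Fin k)) (b : Fin n → ℝ)
    (c : Fin n → Bool) (p : EuclideanSpace ℝ (Fin k)) : Prop :=
  p ∈ closedCell A b c ∧ ∀ w ∈ closedCell A b c, 0 ≤ inner ℝ p (w - p)

/-- The hyperplanes through `p`. -/
noncomputable def activeSet {k n : ℕ} (A : Fin n → EuclideanSpace ℝ (Fin k)) (b : Fin n → ℝ)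
    (p : EuclideanSpace ℝ (Fin k)) : Finset (Fin n) :=
  Finset.univ.filter fun i => inner ℝ (A i) p = b i

/-- The vector `c` with coordinate `i` flipped. -/
def flipBit {n : ℕ} (c : Fin n → Bool) (i : Fin n) : Fin n → Bool :=
  Function.update c i (!c i)

/-- The number of coordinates of `c` equal to `true`. -/
def trueCount {n : ℕ} (c : Fin n → Bool) : ℕ := (Finset.univ.filter fun i => c i = true).card

section Geometry

variable {k n : ℕ} {A : Fin n → EuclideanSpace ℝ (Fin k)} {b : Fin n → ℝ}

lemma bitSign_ne_zero (t : Bool) : bitSign t ≠ 0 := by cases t <;> simp [bitSign]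

lemma bitSign_mul_self (t : Bool) : bitSign t * bitSign t = 1 := by cases t <;> simp [bitSign]

lemma bitSign_of_ne {s t : Bool} (h : s ≠ t) : bitSign s = -bitSign t := by
  cases s <;> cases t <;> simp_all [bitSign]

lemma mem_activeSet {p : EuclideanSpace ℝ (Fin k)} {i : Fin n} :
    i ∈ activeSet A b p ↔ inner ℝ (A i) p = b i := by simp [activeSet]

lemma isClosed_closedCell (c : Fin n → Bool) : IsClosed (closedCell A b c) := by
  simp only [closedCell, Set.ofPred_forall]
  exact isClosed_iInter fun i => isClosed_le continuous_const (by fun_prop)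

lemma convex_closedCell (c : Fin n → Bool) : Convex ℝ (closedCell A b c) := by
  intro x hx y hy s t hs ht hst i
  have h := add_nonneg (mul_nonneg hs (hx i)) (mul_nonneg ht (hy i))
  rw [inner_add_right, inner_smul_right, inner_smul_right]
  have : t = 1 - s := by linarith
  subst this
  linarith

lemma exists_isNearest {c : Fin n → Bool} {x : EuclideanSpace ℝ (Fin k)}
    (hx : x ∈ closedCell A b c) : ∃ p, IsNearest A b c p := by
  obtain ⟨p, hp, h⟩ := exists_norm_eq_iInf_of_complete_convex ⟨x, hx⟩
    (isClosed_closedCell c).isComplete (convex_closedCell c) 0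
  rw [norm_eq_iInf_iff_real_inner_le_zero (convex_closedCell c) hp] at h
  refine ⟨p, hp, fun w hw => ?_⟩
  have := h w hw
  rw [zero_sub, inner_neg_left] at this
  linarith

lemma IsNearest.norm_sq_add_le {c : Fin n → Bool} {p w : EuclideanSpace ℝ (Fin k)}
    (hp : IsNearest A b c p) (hw : w ∈ closedCell A b c) :
    ‖p‖ ^ 2 + ‖w - p‖ ^ 2 ≤ ‖w‖ ^ 2 := by
  have h := hp.2 w hw
  have e := norm_add_sq_real p (w - p)
  rw [add_sub_cancel] at e
  linarith

lemma IsNearest.norm_le {c : Fin n → Bool} {p w : EuclideanSpace ℝ (Fin k)}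
    (hp : IsNearest A b c p) (hw : w ∈ closedCell A b c) : ‖p‖ ≤ ‖w‖ := by
  have := hp.norm_sq_add_le hw
  exact le_of_sq_le_sq (by nlinarith [sq_nonneg ‖w - p‖]) (norm_nonneg _)

lemma IsNearest.eq_of_norm_le {c : Fin n → Bool} {p w : EuclideanSpace ℝ (Fin k)}
    (hp : IsNearest A b c p) (hw : w ∈ closedCell A b c) (h : ‖w‖ ≤ ‖p‖) : w = p := by
  have h1 := hp.norm_sq_add_le hw
  have h2 := pow_le_pow_left₀ (norm_nonneg _) h 2
  have h3 : ‖w - p‖ ^ 2 = 0 := le_antisymm (by linarith) (sq_nonneg _)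
  rw [sq_eq_zero_iff, norm_eq_zero, sub_eq_zero] at h3
  exact h3

lemma eventually_pos_of_pos {p : EuclideanSpace ℝ (Fin k)} (z : EuclideanSpace ℝ (Fin k))
    {s : ℝ} {i : Fin n} (h : 0 < s * (inner ℝ (A i) p - b i)) :
    ∀ᶠ ε : ℝ in nhdsWithin 0 (Set.Ioi 0), 0 < s * (inner ℝ (A i) (p + ε • z) - b i) := by
  have hc : Continuous fun ε : ℝ => s * (inner ℝ (A i) (p + ε • z) - b i) := by fun_prop
  refine (hc.tendsto 0).eventually (lt_mem_nhds ?_) |>.filter_mono nhdsWithin_le_nhds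
  simpa using h

lemma inactive_pos {c : Fin n → Bool} {p : EuclideanSpace ℝ (Fin k)}
    (hp : p ∈ closedCell A b c) {i : Fin n} (hi : i ∉ activeSet A b p) :
    0 < bitSign (c i) * (inner ℝ (A i) p - b i) :=
  lt_of_le_of_ne (hp i) (mul_ne_zero (bitSign_ne_zero _)
    (sub_ne_zero.mpr fun h => hi (mem_activeSet.mpr h))).symm

lemma exists_add_smul_mem {c : Fin n → Bool} {p z : EuclideanSpace ℝ (Fin k)}
    (hp : p ∈ closedCell A b c)
    (hz : ∀ i ∈ activeSet A b p, 0 ≤ bitSign (c i) * inner ℝ (A i) z) :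
    ∃ ε : ℝ, 0 < ε ∧ p + ε • z ∈ closedCell A b c := by
  have h : ∀ᶠ ε : ℝ in nhdsWithin 0 (Set.Ioi 0),
      ∀ i, 0 ≤ bitSign (c i) * (inner ℝ (A i) (p + ε • z) - b i) := by
    rw [Filter.eventually_all]
    intro i
    by_cases hi : i ∈ activeSet A b p
    · filter_upwards [self_mem_nhdsWithin] with ε hε
      rw [inner_add_right, inner_smul_right, mem_activeSet.mp hi]
      have := mul_nonneg (le_of_lt hε) (hz i hi)
      linarith
    · filter_upwards [eventually_pos_of_pos z (inactive_pos hp hi)] with ε hε using hε.le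
  obtain ⟨ε, h1, h2⟩ := (h.and self_mem_nhdsWithin).exists
  exact ⟨ε, h2, h1⟩

lemma IsNearest.inner_nonneg {c : Fin n → Bool} {p z : EuclideanSpace ℝ (Fin k)}
    (hp : IsNearest A b c p)
    (hz : ∀ i ∈ activeSet A b p, 0 ≤ bitSign (c i) * inner ℝ (A i) z) :
    0 ≤ inner ℝ p z := by
  obtain ⟨ε, hε, h⟩ := exists_add_smul_mem hp.1 hz
  have := hp.2 _ h
  rw [add_sub_cancel_left, inner_smul_right] at this
  exact nonneg_of_mul_nonneg_right this hε

lemma exists_inner_eq {S : Finset (Fin n)} (hS : LinearIndependent ℝ fun i : S => A i.1)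
    (t : Fin n → ℝ) : ∃ y, ∀ i ∈ S, inner ℝ (A i) y = t i := by
  obtain ⟨φ, hφ⟩ := LinearMap.exists_extend ((Module.Basis.span hS).constr ℝ fun i : S => t i.1)
  refine ⟨(InnerProductSpace.toDual ℝ _).symm (LinearMap.toContinuousLinearMap φ), fun i hi => ?_⟩
  rw [real_inner_comm, InnerProductSpace.toDual_symm_apply]
  have h1 := (Module.Basis.span hS).constr_basis ℝ (fun i : S => t i.1) ⟨i, hi⟩
  rw [← hφ] at h1
  simpa [Module.Basis.span_apply] using h1

/-- If `p` is nearest for two cells, it is nearest for the cells obtained from the first by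
flipping one coordinate in which they differ. -/
lemma IsNearest.flipBit {c c' : Fin n → Bool} {p : EuclideanSpace ℝ (Fin k)}
    (hI : LinearIndependent ℝ fun i : activeSet A b p => A i.1)
    (hp : IsNearest A b c p) (hp' : IsNearest A b c' p) {i : Fin n} (hi : c' i ≠ c i) :
    IsNearest A b (flipBit c i) p := by
  have hact : inner ℝ (A i) p = b i := by
    have h1 := hp.1 i
    have h2 := hp'.1 i
    rw [bitSign_of_ne hi] at h2
    have h3 : bitSign (c i) * (inner ℝ (A i) p - b i) = 0 := by linarith
    exact sub_eq_zero.mp ((mul_eq_zero.mp h3).resolve_left (bitSign_ne_zero _))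
  have hfi : GeomCompress.flipBit c i i = c' i := by
    have : c' i = !c i := by cases h : c i <;> cases h' : c' i <;> simp_all
    simp [GeomCompress.flipBit, this]
  have hfj : ∀ j, j ≠ i → GeomCompress.flipBit c i j = c j := fun j hj => by
    simp [GeomCompress.flipBit, hj]
  refine ⟨fun j => ?_, fun w hw => ?_⟩
  · by_cases hj : j = i
    · subst hj; simp [hact]
    · rw [hfj j hj]; exact hp.1 j
  obtain ⟨z, hz⟩ := exists_inner_eq hI fun j => if j = i then inner ℝ (A i) (w - p) else 0
  have key : ∀ j ∈ activeSet A b p,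
      0 ≤ bitSign (GeomCompress.flipBit c i j) * inner ℝ (A j) (w - p) := fun j hj => by
    rw [inner_sub_right, mem_activeSet.mp hj]
    exact hw j
  have h1 : 0 ≤ inner ℝ p z := hp'.inner_nonneg fun j hj => by
    rw [hz j hj]
    by_cases hji : j = i
    · subst hji
      have := key j hj
      rw [hfi] at this
      simpa using this
    · simp [hji]
  have h2 : 0 ≤ inner ℝ p (w - p - z) := hp.inner_nonneg fun j hj => by
    rw [inner_sub_right (A j), hz j hj]
    by_cases hji : j = i
    · subst hji; simp
    · have := key j hj
      rw [hfj j hji] at this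
      simpa [hji] using this
  rw [inner_sub_right] at h2
  linarith

/-- Crossing a hyperplane into a cell at no greater distance happens only at hyperplanes through
the nearest point. -/
lemma IsNearest.mem_activeSet_of_norm_le {c : Fin n → Bool} {p q : EuclideanSpace ℝ (Fin k)}
    {i : Fin n} (hp : IsNearest A b c p) (hq : q ∈ closedCell A b (GeomCompress.flipBit c i))
    (h : ‖q‖ ≤ ‖p‖) : i ∈ activeSet A b p := by
  by_contra hi
  have hin : 0 ≤ inner ℝ p (q - p) := hp.inner_nonneg fun j hj => by
    have hji : j ≠ i := fun e => hi (e ▸ hj)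
    rw [inner_sub_right, mem_activeSet.mp hj]
    simpa [GeomCompress.flipBit, hji] using hq j
  have e := norm_add_sq_real p (q - p)
  rw [add_sub_cancel] at e
  have h2 := pow_le_pow_left₀ (norm_nonneg _) h 2
  have h3 : ‖q - p‖ ^ 2 = 0 := le_antisymm (by linarith) (sq_nonneg _)
  rw [sq_eq_zero_iff, norm_eq_zero, sub_eq_zero] at h3
  subst h3
  have h4 := inactive_pos hp.1 hi
  have h5 := hq i
  rw [bitSign_of_ne (t := c i) (by simp [GeomCompress.flipBit])] at h5
  linarith

end Geometry

section Combinatorics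

variable {n : ℕ}

lemma flipBit_self (c : Fin n → Bool) (i : Fin n) : flipBit c i i = !c i := by simp [flipBit]

lemma flipBit_of_ne (c : Fin n → Bool) {i j : Fin n} (h : j ≠ i) : flipBit c i j = c j := by
  simp [flipBit, h]

lemma Adj.exists_flipBit {u c : Fin n → Bool} (h : Adj u c) : ∃ i, u = flipBit c i := by
  obtain ⟨i, hi⟩ := Finset.card_eq_one.mp h
  refine ⟨i, funext fun j => ?_⟩
  have hj : u j ≠ c j ↔ j = i := by
    simpa using congrArg (fun s : Finset (Fin n) => j ∈ s) hi
  by_cases hji : j = i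
  · have := hj.mpr hji
    subst hji
    rw [flipBit_self]
    cases h1 : u j <;> cases h2 : c j <;> simp_all
  · rw [flipBit_of_ne c hji]
    by_contra h'
    exact hji (hj.mp h')

lemma trueCount_lt_of_lt {c u : Fin n → Bool} (h : ∀ i, c i = true → u i = true) (hne : u ≠ c) :
    trueCount c < trueCount u := by
  obtain ⟨i, hi⟩ := Function.ne_iff.mp hne
  refine Finset.card_lt_card (Finset.ssubset_iff_subset_ne.mpr ⟨fun j => ?_, fun e => hi ?_⟩)
  · simpa using h j
  · have hc : c i = true ↔ u i = true := by
      simpa using congrArg (fun s : Finset (Fin n) => i ∈ s) e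
    cases h1 : u i <;> cases h2 : c i <;> simp_all

lemma trueCount_flipBit_lt {c : Fin n → Bool} {i : Fin n} (h : c i = true) :
    trueCount (flipBit c i) < trueCount c := by
  refine trueCount_lt_of_lt (fun j hj => ?_) fun e => ?_
  · by_cases hji : j = i
    · exact hji ▸ h
    · rwa [flipBit_of_ne c hji] at hj
  · have := congrFun e i
    simp [flipBit_self] at this

/-- A vertex of `R` whose incident edges all span a common cube of `R` is a corner. -/
lemma isCorner_of_forall_mem {R : Finset (Fin n → Bool)} {c : Fin n → Bool} {J : Finset (Fin n)}
    (hJ : ∀ i, flipBit c i ∈ R → i ∈ J)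
    (hQ : ∀ u : Fin n → Bool, (∀ i, i ∉ J → u i = c i) → u ∈ R) : IsCorner R c := by
  have hsub : ∀ Q' I', IsCube R Q' I' → c ∈ Q' → I' ⊆ J := by
    intro Q' I' ⟨h1, h2, h3⟩ hc i hi
    obtain ⟨u, hu, hui⟩ := h3 (flipBit c i)
    have : u = flipBit c i := funext fun j => by
      by_cases hj : j ∈ I'
      · exact hui j hj
      · rw [h2 u hu c hc j hj, flipBit_of_ne c (ne_of_mem_of_not_mem hi hj).symm]
    exact hJ i (this ▸ h1 hu)
  refine ⟨Finset.univ.filter fun u => ∀ i, i ∉ J → u i = c i, J, ⟨?_, ?_, ?_⟩, by simp, ?_, ?_, ?_⟩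
  · intro u hu
    exact hQ u (by simpa using hu)
  · intro u hu v hv i hi
    simp only [Finset.mem_filter, Finset.mem_univ, true_and] at hu hv
    rw [hu i hi, hv i hi]
  · intro p
    refine ⟨fun i => if i ∈ J then p i else c i, ?_, fun i hi => by simp [hi]⟩
    simp only [Finset.mem_filter, Finset.mem_univ, true_and]
    intro i hi
    simp [hi]
  · intro Q' I' h hc
    exact Finset.card_le_card (hsub Q' I' h hc)
  · intro Q' I' h hc hcard
    have hI : I' = J := Finset.eq_of_subset_of_card_le (hsub Q' I' h hc) hcard.ge
    subst hI
    obtain ⟨-, h2, h3⟩ := h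
    ext u
    simp only [Finset.mem_filter, Finset.mem_univ, true_and]
    refine ⟨fun hu i hi => h2 u hu c hc i hi, fun hu => ?_⟩
    obtain ⟨w, hw, hwu⟩ := h3 u
    have : w = u := funext fun j => by
      by_cases hj : j ∈ I'
      · exact hwu j hj
      · rw [h2 w hw c hc j hj, hu j hj]
    exact this ▸ hw
  · intro u hu hadj
    obtain ⟨i, rfl⟩ := hadj.exists_flipBit
    simp only [Finset.mem_filter, Finset.mem_univ, true_and]
    intro j hj
    exact flipBit_of_ne c fun e => hj (e ▸ hJ i hu)

lemma degreeIn_le_card {R : Finset (Fin n → Bool)} {c : Fin n → Bool} {J : Finset (Fin n)}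
    (hJ : ∀ i, flipBit c i ∈ R → i ∈ J) : degreeIn R c ≤ J.card := by
  refine (Finset.card_le_card (t := J.image (flipBit c)) fun u hu => ?_).trans
    Finset.card_image_le
  obtain ⟨hu, hadj⟩ := Finset.mem_filter.mp hu
  obtain ⟨i, rfl⟩ := Adj.exists_flipBit hadj
  exact Finset.mem_image_of_mem _ (hJ i hu)

/-- A finite class can be enumerated monotonically with respect to any key. -/
lemma exists_monotone_enumeration {α : Type*} [LinearOrder α] (C : Finset (Fin n → Bool))
    (key : (Fin n → Bool) → α) :
    ∃ v : Fin C.card → (Fin n → Bool), Function.Injective v ∧ (∀ t, v t ∈ C) ∧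
      (∀ c ∈ C, ∃ t, v t = c) ∧ Monotone (key ∘ v) := by
  let e : Fin C.card → (Fin n → Bool) := fun t => (C.equivFin.symm t).1
  refine ⟨e ∘ Tuple.sort (key ∘ e), ?_, fun t => (C.equivFin.symm _).2, fun c hc => ?_,
    Tuple.monotone_sort (key ∘ e)⟩
  · exact (Subtype.val_injective.comp C.equivFin.symm.injective).comp (Equiv.injective _)
  · exact ⟨(Tuple.sort (key ∘ e)).symm (C.equivFin ⟨c, hc⟩), by simp [e]⟩

end Combinatorics

lemma inBall_ofLp_iff {k : ℕ} (x : EuclideanSpace ℝ (Fin k)) : inBall x.ofLp ↔ ‖x‖ < 1 := by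
  rw [inBall, ← EuclideanSpace.real_norm_sq_eq, sq_lt_one_iff₀ (norm_nonneg _)]

/-- The normals `a` as vectors of Euclidean space. -/
def euclideanNormal {k n : ℕ} (a : Fin n → Fin k → ℝ) (i : Fin n) : EuclideanSpace ℝ (Fin k) :=
  WithLp.toLp 2 (a i)

lemma dotR_ofLp {k n : ℕ} (a : Fin n → Fin k → ℝ) (i : Fin n) (x : EuclideanSpace ℝ (Fin k)) :
    dotR (a i) x.ofLp = inner ℝ (euclideanNormal a i) x := by
  simp [dotR, euclideanNormal, PiLp.inner_apply, mul_comm]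

lemma onNoHyperplane_and_signVec_iff {k n : ℕ} (a : Fin n → Fin k → ℝ) (b : Fin n → ℝ)
    (x : EuclideanSpace ℝ (Fin k)) (c : Fin n → Bool) :
    OnNoHyperplane a b x.ofLp ∧ signVec a b x.ofLp = c ↔
      ∀ i, 0 < bitSign (c i) * (inner ℝ (euclideanNormal a i) x - b i) := by
  simp only [OnNoHyperplane, signVec, funext_iff, ← forall_and, dotR_ofLp]
  refine forall_congr' fun i => ?_
  cases c i
  · simp only [bitSign, decide_eq_false_iff_not, not_lt, Bool.false_eq_true, if_false]
    constructor
    · rintro ⟨h1, h2⟩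
      linarith [lt_of_le_of_ne h2 h1]
    · intro h
      exact ⟨by linarith |> ne_of_lt, by linarith⟩
  · simp only [bitSign, decide_eq_true_eq, if_true]
    constructor
    · rintro ⟨-, h⟩
      linarith
    · intro h
      exact ⟨(show b i < _ by linarith).ne', by linarith⟩

section Arrangement

variable {d k n : ℕ} {a : Fin n → Fin k → ℝ} {b : Fin n → ℝ}

lemma SimpleHyperbolicArrangement.card_activeSet_le (hA : SimpleHyperbolicArrangement d a b)
    {p : EuclideanSpace ℝ (Fin k)} (hp : ‖p‖ < 1) :
    (activeSet (euclideanNormal a) b p).card ≤ d := by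
  by_contra! h
  obtain ⟨S, hS, hcard⟩ := Finset.exists_subset_card_eq (Nat.succ_le_of_lt h)
  exact hA.2 S hcard ⟨p.ofLp, (inBall_ofLp_iff p).mpr hp, fun i hi => by
    rw [dotR_ofLp]
    exact mem_activeSet.mp (hS hi)⟩

lemma SimpleHyperbolicArrangement.linearIndependent_activeSet
    (hA : SimpleHyperbolicArrangement d a b) (hdn : d ≤ n)
    {p : EuclideanSpace ℝ (Fin k)} (hp : ‖p‖ < 1) :
    LinearIndependent ℝ
      fun i : activeSet (euclideanNormal a) b p => euclideanNormal a i.1 := by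
  obtain ⟨S, hS, hcard⟩ := Finset.exists_superset_card_eq (hA.card_activeSet_le hp)
    (by simpa using hdn)
  have h1 := (hA.1 S hcard).1.comp (Set.inclusion hS) (Set.inclusion_injective hS)
  exact h1.map' (WithLp.linearEquiv 2 ℝ (Fin k → ℝ)).symm.toLinearMap (LinearEquiv.ker _)

lemma IsInducedClassH.exists_isNearest {C : Finset (Fin n → Bool)} (hC : IsInducedClassH a b C)
    {c : Fin n → Bool} (hc : c ∈ C) :
    ∃ p, IsNearest (euclideanNormal a) b c p ∧ ‖p‖ < 1 := by
  obtain ⟨x, hx, hx'⟩ := (hC c).mp hc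
  have hmem := (onNoHyperplane_and_signVec_iff a b (WithLp.toLp 2 x) c).mp hx'
  obtain ⟨p, hp⟩ := GeomCompress.exists_isNearest
    (A := euclideanNormal a) (b := b) (c := c) fun i => (hmem i).le
  exact ⟨p, hp, (hp.norm_le fun i => (hmem i).le).trans_lt
    ((inBall_ofLp_iff (WithLp.toLp 2 x)).mp hx)⟩

lemma IsInducedClassH.mem_of_mem_closedCell {C : Finset (Fin n → Bool)}
    (hC : IsInducedClassH a b C) (hA : SimpleHyperbolicArrangement d a b) (hdn : d ≤ n)
    {c : Fin n → Bool} {p : EuclideanSpace ℝ (Fin k)} (hp : ‖p‖ < 1)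
    (hpc : p ∈ closedCell (euclideanNormal a) b c) : c ∈ C := by
  obtain ⟨z, hz⟩ := exists_inner_eq (A := euclideanNormal a)
    (hA.linearIndependent_activeSet hdn hp) fun i => bitSign (c i)
  have h : ∀ᶠ ε : ℝ in nhdsWithin 0 (Set.Ioi 0),
      ∀ i, 0 < bitSign (c i) * (inner ℝ (euclideanNormal a i) (p + ε • z) - b i) := by
    rw [Filter.eventually_all]
    intro i
    by_cases hi : i ∈ activeSet (euclideanNormal a) b p
    · filter_upwards [self_mem_nhdsWithin] with ε hε
      have hε' : 0 < ε := hε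
      rw [inner_add_right, inner_smul_right, mem_activeSet.mp hi, hz i hi, add_sub_cancel_left,
        mul_left_comm, bitSign_mul_self, mul_one]
      exact hε'
    · exact eventually_pos_of_pos z (inactive_pos hpc hi)
  have hball : ∀ᶠ ε : ℝ in nhdsWithin 0 (Set.Ioi 0), ‖p + ε • z‖ < 1 := by
    have hc : Continuous fun ε : ℝ => ‖p + ε • z‖ := by fun_prop
    refine (hc.tendsto 0).eventually (gt_mem_nhds ?_) |>.filter_mono nhdsWithin_le_nhds
    simpa using hp
  obtain ⟨ε, h1, h2⟩ := (h.and hball).exists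
  exact (hC c).mpr ⟨(p + ε • z).ofLp, (inBall_ofLp_iff _).mpr h2,
    (onNoHyperplane_and_signVec_iff a b _ c).mpr h1⟩

end Arrangement

/-- Any `d`-maximum class induced by a simple hyperbolic
`d`-arrangement of `n` hyperplanes in `H^k` (`k ≥ d ≥ 1`) can be `d`-corner-peeled. -/
theorem stmt12 (d k n : ℕ) (hd : 1 ≤ d) (hdk : d ≤ k)
    (a : Fin n → Fin k → ℝ) (b : Fin n → ℝ)
    (hA : SimpleHyperbolicArrangement d a b)
    (C : Finset (Fin n → Bool)) (hC : IsInducedClassH a b C) (hmax : IsMaximum C d) :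
    ∃ v : Fin C.card → (Fin n → Bool),
      IsCornerPeeling C v ∧ ∀ t, degreeIn (Peeled C v t) (v t) ≤ d := by
  classical
  have hdn : d ≤ n := by
    obtain ⟨Y, hY, -⟩ := hmax.1.1
    simpa [hY] using Finset.card_le_univ Y
  choose! P hP hP1 using fun c (hc : c ∈ C) => hC.exists_isNearest hc
  let key : (Fin n → Bool) → ℝ ×ₗ ℕ := fun c => toLex (-‖P c‖, trueCount c)
  obtain ⟨v, hinj, hmem, hsurj, hmono⟩ := exists_monotone_enumeration C key
  suffices H : ∀ t, ∃ J : Finset (Fin n), J.card ≤ d ∧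
      (∀ i, flipBit (v t) i ∈ Peeled C v t → i ∈ J) ∧
      ∀ u : Fin n → Bool, (∀ i, i ∉ J → u i = v t i) → u ∈ Peeled C v t by
    refine ⟨v, ⟨hinj, hmem, fun t => ?_⟩, fun t => ?_⟩
    · obtain ⟨J, -, h1, h2⟩ := H t
      exact isCorner_of_forall_mem h1 h2
    · obtain ⟨J, h0, h1, -⟩ := H t
      exact (degreeIn_le_card h1).trans h0
  intro t
  have hR : ∀ u ∈ Peeled C v t, u ∈ C ∧ key (v t) ≤ key u := by
    intro u hu
    simp only [Peeled, Finset.mem_sdiff, Finset.mem_image, Finset.mem_filter, Finset.mem_univ,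
      true_and, not_exists, not_and] at hu
    obtain ⟨s, rfl⟩ := hsurj u hu.1
    exact ⟨hu.1, hmono (not_lt.mp fun hlt => hu.2 s hlt rfl)⟩
  have hR' : ∀ u ∈ C, u = v t ∨ key (v t) < key u → u ∈ Peeled C v t := by
    intro u hu hkey
    simp only [Peeled, Finset.mem_sdiff, Finset.mem_image, Finset.mem_filter, Finset.mem_univ,
      true_and, not_exists, not_and]
    refine ⟨hu, ?_⟩
    rintro s hs rfl
    rcases hkey with h | h
    · exact hs.ne (hinj h)
    · exact absurd (hmono hs.le) (not_le.mpr h)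
  have hc := hmem t
  set c := v t
  have hactive : ∀ i, flipBit c i ∈ Peeled C v t → i ∈ activeSet (euclideanNormal a) b (P c) := by
    intro i hi
    obtain ⟨h1, h2⟩ := hR _ hi
    refine (hP c hc).mem_activeSet_of_norm_le (hP _ h1).1 ?_
    rcases Prod.Lex.toLex_le_toLex.mp h2 with h | h
    · exact (neg_lt_neg_iff.mp h).le
    · exact (neg_inj.mp h.1).ge
  refine ⟨Finset.univ.filter fun i => flipBit c i ∈ Peeled C v t,
    (Finset.card_le_card fun i hi => hactive i (Finset.mem_filter.mp hi).2).trans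
      (hA.card_activeSet_le (hP1 c hc)), by simp, fun u hu => ?_⟩
  replace hu : ∀ i, u i ≠ c i → flipBit c i ∈ Peeled C v t := fun i hi => by
    by_contra h
    exact hi (hu i (by simpa using h))
  have hpu : P c ∈ closedCell (euclideanNormal a) b u := fun i => by
    by_cases hi : u i = c i
    · rw [hi]; exact (hP c hc).1 i
    · rw [mem_activeSet.mp (hactive i (hu i hi))]; simp
  have huC : u ∈ C := hC.mem_of_mem_closedCell hA hdn (hP1 c hc) hpu
  refine hR' u huC ?_
  by_cases hne : u = c
  · exact Or.inl hne
  right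
  have hle : ‖P u‖ ≤ ‖P c‖ := (hP u huC).norm_le hpu
  rcases hle.lt_or_eq with hlt | heq
  · exact Prod.Lex.toLex_lt_toLex.mpr (Or.inl (neg_lt_neg hlt))
  refine Prod.Lex.toLex_lt_toLex.mpr (Or.inr ⟨by simp [heq], trueCount_lt_of_lt ?_ hne⟩)
  have hPu : P c = P u := (hP u huC).eq_of_norm_le hpu heq.ge
  intro i hi
  by_contra hui
  have hdiff : u i ≠ c i := fun e => hui (e.trans hi)
  have hflip := hu i hdiff
  obtain ⟨hfC, hfkey⟩ := hR _ hflip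
  have hnear : IsNearest (euclideanNormal a) b (flipBit c i) (P c) :=
    (hP c hc).flipBit (hA.linearIndependent_activeSet hdn (hP1 c hc)) (hPu ▸ hP u huC) hdiff
  have hnorm : ‖P (flipBit c i)‖ = ‖P c‖ :=
    le_antisymm ((hP _ hfC).norm_le hnear.1) (hnear.norm_le (hP _ hfC).1)
  rcases Prod.Lex.toLex_le_toLex.mp hfkey with h | h
  · exact absurd h (by simp [hnorm])
  · exact absurd h.2 (not_le.mpr (trueCount_flipBit_lt hi))

end GeomCompress
end
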